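/- arXiv:1311.0853 — 5 statements merged into one kernel-verified Lean document; each statement's English description precedes it below -/
import Mathlib

section
/- For every N ≥ 1, every i with 1 ≤ i ≤ N, and every f ∈ Λ̄[x], one has φ_{i,N}(D_k(f)) = D_{i,N}(φ_{i,N}(f)); that is, the rational Dunkl operator at infinity reduces to the usual rational Dunkl operator under the finite-dimensional specialization homomorphisms. -/
open Polynomial MvPolynomial

noncomputable section

/-- Λ̄ = ℂ[p₀,p₁,…] -/
abbrev Lam : Type := MvPolynomial ℕ ℂ
/-- Λ̄[x] -/
abbrev LamX : Type := Polynomial Lam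

/-- the derivation on coefficients: p_l ↦ l·x^{l-1} -/
def coeffDer : Derivation ℂ Lam LamX :=
  MvPolynomial.mkDerivation ℂ (fun l => (l : LamX) * Polynomial.X ^ (l - 1))

/-- ∂ : the ℂ-derivation of Λ̄[x] with ∂x = 1, ∂p_l = l x^{l-1}. -/
def pd (f : LamX) : LamX :=
  Polynomial.derivative f + f.sum (fun i c => coeffDer c * Polynomial.X ^ i)

/-- Δ(x^l). -/
def Dvals (l : ℕ) : LamX :=
  if l = 0 then 0 else
    (∑ j ∈ Finset.range l, Polynomial.X ^ (l - 1 - j) * Polynomial.C (MvPolynomial.X j))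
      - (l : LamX) * Polynomial.X ^ (l - 1)

/-- Δ : Λ̄-linear, Δ(x^l f) = Δ(x^l)·f. -/
def Del (f : LamX) : LamX := f.sum (fun l c => Polynomial.C c * Dvals l)

/-- Dunkl operator at infinity, D_k = ∂ − kΔ. -/
def Dk (k : ℂ) (f : LamX) : LamX := pd f - k • Del f

/-- E : Λ̄[x] → Λ̄, x^l f ↦ p_l f. -/
def E (f : LamX) : Lam := f.sum (fun l c => c * MvPolynomial.X l)

/-- L^{(r)} = E ∘ D_k^r restricted to Λ̄. -/
def Lr (k : ℂ) (r : ℕ) (f : Lam) : Lam := E ((Dk k)^[r] (Polynomial.C f))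

end

noncomputable section

variable (N : ℕ)

/-- φ_{i,N} : Λ̄[x] → ℂ[x₁,…,x_N], x ↦ x_i, p_l ↦ x₁^l + ⋯ + x_N^l. -/
def phiiN (i : Fin N) (f : LamX) : MvPolynomial (Fin N) ℂ :=
  Polynomial.eval₂
    (MvPolynomial.aeval (fun l : ℕ => ∑ j : Fin N, MvPolynomial.X j ^ l) :
      Lam →ₐ[ℂ] MvPolynomial (Fin N) ℂ).toRingHom
    (MvPolynomial.X i) f

/-- the canonical embedding of ℂ[x₁,…,x_N] into its field of fractions
ℂ(x₁,…,x_N). -/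
def emb (f : MvPolynomial (Fin N) ℂ) : FractionRing (MvPolynomial (Fin N) ℂ) :=
  algebraMap _ _ f

/-- φ_{i,N} on the coefficient ring: p_l ↦ x₁^l + ⋯ + x_N^l. -/
def psumHom : Lam →ₐ[ℂ] MvPolynomial (Fin N) ℂ :=
  MvPolynomial.aeval (fun l : ℕ => ∑ j : Fin N, MvPolynomial.X j ^ l)

/-- φ_{i,N} as a ring homomorphism. -/
def phiHom (i : Fin N) : LamX →+* MvPolynomial (Fin N) ℂ :=
  Polynomial.eval₂RingHom (psumHom N).toRingHom (MvPolynomial.X i)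

theorem phiiN_eq (i : Fin N) (f : LamX) : phiiN N i f = phiHom N i f := rfl

theorem psumHom_X (l : ℕ) :
    psumHom N (MvPolynomial.X l) = ∑ j : Fin N, MvPolynomial.X j ^ l := by
  simp [psumHom]

theorem phiHom_C (i : Fin N) (c : Lam) : phiHom N i (Polynomial.C c) = psumHom N c := by
  simp [phiHom]

theorem phiHom_X (i : Fin N) : phiHom N i Polynomial.X = MvPolynomial.X i := by
  simp [phiHom]

theorem phiHom_monomial (i : Fin N) (n : ℕ) (c : Lam) :
    phiHom N i (Polynomial.monomial n c) = psumHom N c * MvPolynomial.X i ^ n := by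
  rw [← Polynomial.C_mul_X_pow_eq_monomial, map_mul, map_pow, phiHom_C, phiHom_X]

theorem phiHom_smul (i : Fin N) (k : ℂ) (f : LamX) :
    phiHom N i (k • f) = k • phiHom N i f := by
  have h : k • f = Polynomial.C (MvPolynomial.C k) * f := by
    rw [Polynomial.C_mul', ← MvPolynomial.algebraMap_eq, algebraMap_smul]
  rw [h, map_mul, phiHom_C, ← MvPolynomial.algebraMap_eq, AlgHom.commutes, Algebra.smul_def]

theorem pderiv_psum (i : Fin N) (l : ℕ) :
    MvPolynomial.pderiv i (∑ j : Fin N, (MvPolynomial.X j : MvPolynomial (Fin N) ℂ) ^ l)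
      = (l : MvPolynomial (Fin N) ℂ) * MvPolynomial.X i ^ (l - 1) := by
  rw [map_sum, Finset.sum_eq_single i]
  · rw [MvPolynomial.pderiv_pow, MvPolynomial.pderiv_X_self, mul_one]
  · intro j _ hj
    rw [MvPolynomial.pderiv_pow, MvPolynomial.pderiv_X_of_ne hj, mul_zero]
  · simp

theorem phiHom_coeffDer (i : Fin N) (c : Lam) :
    phiHom N i (coeffDer c) = MvPolynomial.pderiv i (psumHom N c) := by
  induction c using MvPolynomial.induction_on with
  | C a =>
    rw [← MvPolynomial.algebraMap_eq, Derivation.map_algebraMap, AlgHom.commutes,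
      Derivation.map_algebraMap, map_zero]
  | add p q hp hq => simp only [map_add, hp, hq]
  | mul_X p l hp =>
    have hX : coeffDer (MvPolynomial.X l) = (l : LamX) * Polynomial.X ^ (l - 1) :=
      MvPolynomial.mkDerivation_X _ _ _
    rw [Derivation.leibniz, map_mul, Derivation.leibniz, hX, map_add, psumHom_X, pderiv_psum,
      ← Polynomial.C_mul', ← Polynomial.C_mul']
    simp only [map_mul, map_natCast, map_pow, phiHom_C, phiHom_X, psumHom_X, hp, smul_eq_mul]

theorem pd_add (f g : LamX) : pd (f + g) = pd f + pd g := by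
  unfold pd
  rw [Polynomial.sum_add_index f g _ (by simp) (by simp [add_mul]), map_add]
  ring

theorem Del_add (f g : LamX) : Del (f + g) = Del f + Del g := by
  unfold Del
  rw [Polynomial.sum_add_index f g _ (by simp) (by simp [add_mul])]

theorem phiHom_pd (i : Fin N) (f : LamX) :
    phiHom N i (pd f) = MvPolynomial.pderiv i (phiHom N i f) := by
  induction f using Polynomial.induction_on' with
  | add p q hp hq => rw [pd_add, map_add, hp, hq, map_add, map_add]
  | monomial n c =>
    rw [pd, Polynomial.sum_monomial_index c _ (by simp), Polynomial.derivative_monomial, map_add,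
      phiHom_monomial, phiHom_monomial, map_mul, map_mul, map_natCast, phiHom_coeffDer, map_pow,
      phiHom_X, MvPolynomial.pderiv_mul, MvPolynomial.pderiv_pow, MvPolynomial.pderiv_X_self]
    ring

theorem rename_psumHom (e : Equiv.Perm (Fin N)) (c : Lam) :
    MvPolynomial.rename e (psumHom N c) = psumHom N c := by
  have h : (MvPolynomial.rename e).comp (psumHom N) = psumHom N := by
    ext l : 1
    rw [AlgHom.comp_apply, psumHom_X, map_sum]
    simp only [map_pow, MvPolynomial.rename_X]
    exact Equiv.sum_comp e
      (fun j : Fin N => (MvPolynomial.X j : MvPolynomial (Fin N) ℂ) ^ l)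
  exact DFunLike.congr_fun h c

theorem phiHom_Dvals (i : Fin N) (l : ℕ) :
    phiHom N i (Dvals l) = ∑ j ∈ Finset.univ.erase i,
      ∑ m ∈ Finset.range l, (MvPolynomial.X i : MvPolynomial (Fin N) ℂ) ^ (l - 1 - m)
        * MvPolynomial.X j ^ m := by
  rw [Finset.sum_erase_eq_sub (Finset.mem_univ i)]
  have hi : ∑ m ∈ Finset.range l, (MvPolynomial.X i : MvPolynomial (Fin N) ℂ) ^ (l - 1 - m)
      * MvPolynomial.X i ^ m = (l : MvPolynomial (Fin N) ℂ) * MvPolynomial.X i ^ (l - 1) := by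
    rw [Finset.sum_congr rfl (g := fun _ => MvPolynomial.X i ^ (l - 1)), Finset.sum_const,
      Finset.card_range, nsmul_eq_mul]
    intro m hm
    have := Finset.mem_range.1 hm
    rw [← pow_add]
    congr 1
    lia
  rw [hi, Finset.sum_comm]
  unfold Dvals
  split_ifs with h
  · simp [h]
  · simp only [map_sub, map_sum, map_mul, map_pow, map_natCast, phiHom_X, phiHom_C, psumHom_X,
      Finset.mul_sum]

/-- The divided difference of `φ (c x^n)`; the coefficient is symmetric, so only the power of
`x_i` contributes. -/
theorem monomial_divided_difference {i j : Fin N} (hj : j ≠ i) (n : ℕ) (c : Lam) :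
    (emb N (phiHom N i (Polynomial.monomial n c))
        - emb N (MvPolynomial.rename (Equiv.swap i j) (phiHom N i (Polynomial.monomial n c))))
      / (emb N (MvPolynomial.X i) - emb N (MvPolynomial.X j))
      = emb N (psumHom N c * ∑ m ∈ Finset.range n,
          (MvPolynomial.X i : MvPolynomial (Fin N) ℂ) ^ (n - 1 - m) * MvPolynomial.X j ^ m) := by
  have hne : emb N (MvPolynomial.X i) - emb N (MvPolynomial.X j) ≠ 0 := by
    rw [sub_ne_zero]
    intro h
    exact hj (MvPolynomial.X_injective (IsFractionRing.injective _ _ h)).symm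
  rw [div_eq_iff hne, phiHom_monomial, map_mul, rename_psumHom, map_pow, MvPolynomial.rename_X,
    Equiv.swap_apply_left]
  unfold emb
  rw [← map_sub, ← map_sub, ← map_mul]
  congr 1
  have hg := (Commute.all (MvPolynomial.X j : MvPolynomial (Fin N) ℂ)
    (MvPolynomial.X i)).geom_sum₂_mul n
  simp only [mul_comm (MvPolynomial.X j ^ _)] at hg
  linear_combination psumHom N c * hg

theorem emb_phiHom_Del (i : Fin N) (f : LamX) :
    emb N (phiHom N i (Del f)) = ∑ j ∈ Finset.univ.erase i,
      (emb N (phiHom N i f) - emb N (MvPolynomial.rename (Equiv.swap i j) (phiHom N i f)))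
        / (emb N (MvPolynomial.X i) - emb N (MvPolynomial.X j)) := by
  induction f using Polynomial.induction_on' with
  | add p q hp hq =>
    have hadd (a b : MvPolynomial (Fin N) ℂ) : emb N (a + b) = emb N a + emb N b :=
      map_add _ _ _
    rw [Del_add, map_add, hadd, hp, hq, ← Finset.sum_add_distrib]
    refine Finset.sum_congr rfl fun j _ => ?_
    rw [map_add, map_add, hadd, hadd]
    ring
  | monomial n c =>
    rw [Finset.sum_congr rfl fun j hj =>
      monomial_divided_difference N (Finset.ne_of_mem_erase hj) n c, Del,
      Polynomial.sum_monomial_index c _ (by simp), map_mul, phiHom_C, phiHom_Dvals,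
      Finset.mul_sum]
    exact map_sum _ _ _

/-- the rational Dunkl operator at infinity reduces to the usual rational
Dunkl operator D_{i,N} = ∂/∂x_i − k Σ_{j≠i} (x_i−x_j)^{-1}(1−σ_{ij}) under the
specialization φ_{i,N}.  The identity is stated inside the field of rational functions
ℂ(x₁,…,x_N) (into which the polynomial ring embeds), where the division by x_i − x_j
is available. -/
theorem dunkl_at_infinity_specializes (k : ℂ) (N : ℕ) (hN : 1 ≤ N) (i : Fin N)
    (f : LamX) :
    emb N (phiiN N i (Dk k f)) =
      emb N (MvPolynomial.pderiv i (phiiN N i f))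
        - k • ∑ j ∈ Finset.univ.erase i,
            (emb N (phiiN N i f)
              - emb N (MvPolynomial.rename (Equiv.swap i j) (phiiN N i f)))
            / (emb N (MvPolynomial.X i) - emb N (MvPolynomial.X j)) := by
  have hsmul (g : MvPolynomial (Fin N) ℂ) : emb N (k • g) = k • emb N g :=
    map_smul (IsScalarTower.toAlgHom ℂ (MvPolynomial (Fin N) ℂ)
      (FractionRing (MvPolynomial (Fin N) ℂ))) k g
  have hsub (a b : MvPolynomial (Fin N) ℂ) : emb N (a - b) = emb N a - emb N b :=
    map_sub _ _ _
  rw [phiiN_eq, phiiN_eq, ← emb_phiHom_Del, Dk, map_sub, phiHom_smul, phiHom_pd, hsub, hsmul]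

end
end

section
/- The rational CMS integrals at infinity commute: for all r, s ≥ 1 and all f ∈ Λ̄, L^{(r)}(L^{(s)}(f)) = L^{(s)}(L^{(r)}(f)). -/
open Polynomial MvPolynomial

noncomputable section

namespace RationalDunkl

section FiniteVariables

variable {σ R : Type*} [CommRing R]

theorem X_sub_X_ne_zero [IsDomain R] {i j : σ} (h : i ≠ j) :
    (MvPolynomial.X i - MvPolynomial.X j : MvPolynomial σ R) ≠ 0 :=
  sub_ne_zero.2 fun e => h (MvPolynomial.X_injective e)

/-- The partial derivative as a linear endomorphism. -/
def partialEnd (i : σ) : Module.End R (MvPolynomial σ R) :=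
  (MvPolynomial.pderiv i).toLinearMap

theorem partialEnd_apply (i : σ) (f : MvPolynomial σ R) :
    partialEnd i f = MvPolynomial.pderiv i f := rfl

theorem lie_partialEnd_partialEnd (i j : σ) :
    ⁅partialEnd (R := R) i, partialEnd (R := R) j⁆ = 0 := by
  classical
  have h : ⁅(MvPolynomial.pderiv i : Derivation R (MvPolynomial σ R) _),
      (MvPolynomial.pderiv j : Derivation R (MvPolynomial σ R) _)⁆ = 0 := by
    refine MvPolynomial.derivation_ext fun l => ?_
    simp [Derivation.commutator_apply, MvPolynomial.pderiv_X, Pi.single_apply, apply_ite]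
  refine LinearMap.ext fun f => ?_
  exact DFunLike.congr_fun h f

variable [DecidableEq σ]

/-- The action of the transposition of `i` and `j` on polynomials. -/
def transpose (i j : σ) : MvPolynomial σ R →ₐ[R] MvPolynomial σ R :=
  MvPolynomial.rename (Equiv.swap i j)

@[simp]
theorem transpose_X (i j l : σ) :
    transpose i j (MvPolynomial.X l : MvPolynomial σ R) =
      MvPolynomial.X (Equiv.swap i j l) :=
  MvPolynomial.rename_X _ _

@[simp]
theorem transpose_self (i : σ) (f : MvPolynomial σ R) : transpose i i f = f := by
  simp [transpose]

theorem transpose_comm (i j : σ) (f : MvPolynomial σ R) : transpose i j f = transpose j i f := by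
  simp [transpose, Equiv.swap_comm]

theorem transpose_transpose_of_distinct {a b c : σ} (hab : a ≠ b) (hac : a ≠ c) (hbc : b ≠ c)
    (f : MvPolynomial σ R) :
    transpose a b (transpose b c f) = transpose a c (transpose a b f) := by
  simp only [transpose, MvPolynomial.rename_rename]
  congr 2
  ext x
  simp only [Function.comp_apply, Equiv.swap_apply_def]
  grind

theorem transpose_transpose_of_disjoint {a b c d : σ} (hac : a ≠ c) (had : a ≠ d) (hbc : b ≠ c)
    (hbd : b ≠ d) (f : MvPolynomial σ R) :
    transpose a b (transpose c d f) = transpose c d (transpose a b f) := by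
  simp only [transpose, MvPolynomial.rename_rename]
  congr 2
  ext x
  simp only [Function.comp_apply, Equiv.swap_apply_def]
  grind

theorem pderiv_transpose (i j l : σ) (f : MvPolynomial σ R) :
    MvPolynomial.pderiv l (transpose i j f) =
      transpose i j (MvPolynomial.pderiv (Equiv.swap i j l) f) := by
  have h := MvPolynomial.pderiv_rename (Equiv.swap i j).injective (Equiv.swap i j l) f
  rwa [Equiv.swap_apply_self] at h

theorem X_sub_X_dvd_sub_transpose (i j : σ) (f : MvPolynomial σ R) :
    (MvPolynomial.X i - MvPolynomial.X j) ∣ f - transpose i j f := by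
  induction f using MvPolynomial.induction_on with
  | C a => simp [transpose]
  | add p q hp hq =>
    rw [map_add, add_sub_add_comm]
    exact dvd_add hp hq
  | mul_X p l hp =>
    have hl : (MvPolynomial.X i - MvPolynomial.X j : MvPolynomial σ R) ∣
        MvPolynomial.X l - MvPolynomial.X (Equiv.swap i j l) := by
      rw [Equiv.swap_apply_def]
      split_ifs with h₁ h₂
      · rw [h₁]
      · rw [h₂, ← neg_sub (MvPolynomial.X i), dvd_neg]
      · simp
    have e : p * MvPolynomial.X l - transpose i j (p * MvPolynomial.X l) =
        (p - transpose i j p) * MvPolynomial.X l +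
          transpose i j p * (MvPolynomial.X l - MvPolynomial.X (Equiv.swap i j l)) := by
      rw [map_mul, transpose_X]
      ring
    rw [e]
    exact dvd_add (hp.mul_right _) (hl.mul_left _)

variable [IsDomain R]

/-- The divided difference `f ↦ (f - s_{ij} f) / (x_i - x_j)`, set to zero when `i = j`. -/
def divDiff (i j : σ) : Module.End R (MvPolynomial σ R) where
  toFun f := if i = j then 0 else (X_sub_X_dvd_sub_transpose i j f).choose
  map_add' f g := by
    split_ifs with h
    · simp
    · apply mul_left_cancel₀ (X_sub_X_ne_zero (R := R) h)
      rw [mul_add, ← (X_sub_X_dvd_sub_transpose i j (f + g)).choose_spec,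
        ← (X_sub_X_dvd_sub_transpose i j f).choose_spec,
        ← (X_sub_X_dvd_sub_transpose i j g).choose_spec, map_add]
      ring
  map_smul' c f := by
    split_ifs with h
    · simp
    · apply mul_left_cancel₀ (X_sub_X_ne_zero (R := R) h)
      rw [RingHom.id_apply, mul_smul_comm,
        ← (X_sub_X_dvd_sub_transpose i j (c • f)).choose_spec,
        ← (X_sub_X_dvd_sub_transpose i j f).choose_spec, map_smul, smul_sub]

@[simp]
theorem divDiff_self (i : σ) : (divDiff i i : Module.End R (MvPolynomial σ R)) = 0 := by
  refine LinearMap.ext fun f => ?_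
  simp [divDiff]

theorem X_sub_X_mul_divDiff (i j : σ) (f : MvPolynomial σ R) :
    (MvPolynomial.X i - MvPolynomial.X j) * divDiff i j f = f - transpose i j f := by
  by_cases h : i = j
  · subst h
    simp
  · rw [divDiff, LinearMap.coe_mk, AddHom.coe_mk, if_neg h,
      ← (X_sub_X_dvd_sub_transpose i j f).choose_spec]

theorem divDiff_eq_of_mul_eq {i j : σ} (h : i ≠ j) {f g : MvPolynomial σ R}
    (e : (MvPolynomial.X i - MvPolynomial.X j) * g = f - transpose i j f) :
    divDiff i j f = g :=
  mul_left_cancel₀ (X_sub_X_ne_zero h) (by rw [X_sub_X_mul_divDiff, e])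

theorem divDiff_comm (i j : σ) :
    (divDiff j i : Module.End R (MvPolynomial σ R)) = -divDiff i j := by
  by_cases h : i = j
  · subst h
    simp
  · refine LinearMap.ext fun f => divDiff_eq_of_mul_eq (Ne.symm h) ?_
    rw [LinearMap.neg_apply, transpose_comm j i]
    linear_combination X_sub_X_mul_divDiff i j f

theorem X_sub_X_mul_partialEnd_divDiff (a i j : σ) (f : MvPolynomial σ R) :
    (MvPolynomial.X i - MvPolynomial.X j) * partialEnd a (divDiff i j f) =
      partialEnd a f - transpose i j (partialEnd (Equiv.swap i j a) f) -
        (Pi.single (M := fun _ => MvPolynomial σ R) a 1 i -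
          Pi.single (M := fun _ => MvPolynomial σ R) a 1 j) * divDiff i j f := by
  have h := congrArg (MvPolynomial.pderiv a) (X_sub_X_mul_divDiff i j f)
  rw [Derivation.leibniz, map_sub, map_sub, MvPolynomial.pderiv_X, MvPolynomial.pderiv_X,
    pderiv_transpose] at h
  simp only [smul_eq_mul] at h
  simp only [partialEnd_apply]
  linear_combination h

theorem lie_partialEnd_divDiff_of_ne {a i j : σ} (hi : a ≠ i) (hj : a ≠ j) :
    ⁅partialEnd (R := R) a, divDiff (R := R) i j⁆ = 0 := by
  by_cases hij : i = j
  · simp [hij, LieRing.of_associative_ring_bracket]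
  refine LinearMap.ext fun f => ?_
  rw [LieRing.of_associative_ring_bracket, LinearMap.sub_apply, LinearMap.zero_apply, sub_eq_zero,
    Module.End.mul_apply, Module.End.mul_apply]
  refine (divDiff_eq_of_mul_eq hij ?_).symm
  rw [X_sub_X_mul_partialEnd_divDiff, Equiv.swap_apply_of_ne_of_ne hi hj,
    Pi.single_eq_of_ne hi.symm, Pi.single_eq_of_ne hj.symm]
  simp

theorem lie_partialEnd_add_partialEnd_divDiff (i j : σ) :
    ⁅partialEnd (R := R) i + partialEnd (R := R) j, divDiff (R := R) i j⁆ = 0 := by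
  by_cases hij : i = j
  · simp [hij, LieRing.of_associative_ring_bracket]
  refine LinearMap.ext fun f => ?_
  rw [LieRing.of_associative_ring_bracket, LinearMap.sub_apply, LinearMap.zero_apply, sub_eq_zero,
    Module.End.mul_apply, Module.End.mul_apply]
  refine (divDiff_eq_of_mul_eq hij ?_).symm
  rw [LinearMap.add_apply, mul_add, X_sub_X_mul_partialEnd_divDiff,
    X_sub_X_mul_partialEnd_divDiff, Equiv.swap_apply_left, Equiv.swap_apply_right,
    Pi.single_eq_same, Pi.single_eq_same, Pi.single_eq_of_ne hij,
    Pi.single_eq_of_ne (Ne.symm hij), LinearMap.add_apply, map_add]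
  ring

theorem mul_divDiff_divDiff (a b c d : σ) (f : MvPolynomial σ R) :
    (MvPolynomial.X a - MvPolynomial.X b) * (MvPolynomial.X c - MvPolynomial.X d) *
        (MvPolynomial.X (Equiv.swap a b c) - MvPolynomial.X (Equiv.swap a b d)) *
          divDiff a b (divDiff c d f) =
      (MvPolynomial.X (Equiv.swap a b c) - MvPolynomial.X (Equiv.swap a b d)) *
          (f - transpose c d f) -
        (MvPolynomial.X c - MvPolynomial.X d) *
          (transpose a b f - transpose a b (transpose c d f)) := by
  have h₁ := X_sub_X_mul_divDiff a b (divDiff c d f)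
  have h₂ := X_sub_X_mul_divDiff c d f
  have h₃ := congrArg (transpose a b) h₂
  simp only [map_mul, map_sub, transpose_X] at h₃
  linear_combination (MvPolynomial.X c - MvPolynomial.X d) *
    (MvPolynomial.X (Equiv.swap a b c) - MvPolynomial.X (Equiv.swap a b d)) * h₁ +
    (MvPolynomial.X (Equiv.swap a b c) - MvPolynomial.X (Equiv.swap a b d)) * h₂ -
    (MvPolynomial.X c - MvPolynomial.X d) * h₃

theorem lie_divDiff_divDiff_of_disjoint {a b c d : σ} (hac : a ≠ c) (had : a ≠ d) (hbc : b ≠ c)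
    (hbd : b ≠ d) :
    ⁅divDiff (R := R) a b, divDiff (R := R) c d⁆ = 0 := by
  by_cases hab : a = b
  · simp [hab, LieRing.of_associative_ring_bracket]
  by_cases hcd : c = d
  · simp [hcd, LieRing.of_associative_ring_bracket]
  refine LinearMap.ext fun f => ?_
  rw [LieRing.of_associative_ring_bracket, LinearMap.sub_apply, LinearMap.zero_apply, sub_eq_zero,
    Module.End.mul_apply, Module.End.mul_apply]
  have h₁ := mul_divDiff_divDiff a b c d f
  have h₂ := mul_divDiff_divDiff c d a b f
  rw [Equiv.swap_apply_of_ne_of_ne hac.symm hbc.symm,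
    Equiv.swap_apply_of_ne_of_ne had.symm hbd.symm] at h₁
  rw [Equiv.swap_apply_of_ne_of_ne hac had, Equiv.swap_apply_of_ne_of_ne hbc hbd,
    ← transpose_transpose_of_disjoint hac had hbc hbd] at h₂
  have x := X_sub_X_ne_zero (R := R) hab
  have y := X_sub_X_ne_zero (R := R) hcd
  refine mul_left_cancel₀ (mul_ne_zero (mul_ne_zero x y) (mul_ne_zero x y)) ?_
  linear_combination (MvPolynomial.X a - MvPolynomial.X b) * h₁ -
    (MvPolynomial.X c - MvPolynomial.X d) * h₂

/-- The classical Yang–Baxter relation for divided differences. -/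
theorem lie_divDiff_yangBaxter {i j l : σ} (hij : i ≠ j) (hil : i ≠ l) (hjl : j ≠ l) :
    ⁅divDiff (R := R) i j, divDiff (R := R) j l⁆ + ⁅divDiff (R := R) i l, divDiff (R := R) j i⁆ +
      ⁅divDiff (R := R) i l, divDiff (R := R) j l⁆ = 0 := by
  refine LinearMap.ext fun f => ?_
  rw [divDiff_comm i j]
  simp only [LieRing.of_associative_ring_bracket, LinearMap.sub_apply, LinearMap.add_apply,
    LinearMap.zero_apply, Module.End.mul_apply, LinearMap.neg_apply, map_neg]
  have h₁ := mul_divDiff_divDiff i j j l f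
  have h₂ := mul_divDiff_divDiff j l i j f
  have h₃ := mul_divDiff_divDiff i l i j f
  have h₄ := mul_divDiff_divDiff i j i l f
  have h₅ := mul_divDiff_divDiff i l j l f
  have h₆ := mul_divDiff_divDiff j l i l f
  simp only [Equiv.swap_apply_left, Equiv.swap_apply_right,
    Equiv.swap_apply_of_ne_of_ne hij hil, Equiv.swap_apply_of_ne_of_ne hij.symm hjl,
    Equiv.swap_apply_of_ne_of_ne hil.symm hjl.symm] at h₁ h₂ h₃ h₄ h₅ h₆
  have t₁ := transpose_transpose_of_distinct hij hil hjl f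
  have t₂ := transpose_transpose_of_distinct hjl hij.symm hil.symm f
  have t₃ := transpose_transpose_of_distinct hil hij hjl.symm f
  have t₄ := transpose_transpose_of_distinct hij.symm hjl hil f
  simp only [transpose_comm l i, transpose_comm j i, transpose_comm l j] at t₁ t₂ t₃ t₄
  have x := X_sub_X_ne_zero (R := R) hij
  have y := X_sub_X_ne_zero (R := R) hil
  have z := X_sub_X_ne_zero (R := R) hjl
  refine mul_left_cancel₀ (mul_ne_zero (mul_ne_zero x y) z) ?_
  linear_combination h₁ - h₂ + h₃ + h₄ - h₅ - h₆ -
    (MvPolynomial.X i - MvPolynomial.X j) * t₁ - (MvPolynomial.X i - MvPolynomial.X l) * t₂ -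
    (MvPolynomial.X j - MvPolynomial.X l) * t₃ + (MvPolynomial.X i - MvPolynomial.X j) * t₄

end FiniteVariables

/-- Commutativity of Dunkl-type elements `∂ᵢ - k ∑ₗ Δᵢₗ` in a Lie algebra. -/
theorem lie_dunkl_eq_zero {σ R A : Type*} [Fintype σ] [DecidableEq σ] [CommRing R] [LieRing A]
    [LieAlgebra R A] (d : σ → A) (δ : σ → σ → A) (k : R)
    (hd : ∀ i j, ⁅d i, d j⁆ = 0) (hδ : ∀ i, δ i i = 0) (hδ_comm : ∀ i j, δ j i = -δ i j)
    (hdδ : ∀ a i j, a ≠ i → a ≠ j → ⁅d a, δ i j⁆ = 0)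
    (hdδ_add : ∀ i j, ⁅d i + d j, δ i j⁆ = 0)
    (hδδ : ∀ a b i j, a ≠ i → a ≠ j → b ≠ i → b ≠ j → ⁅δ a b, δ i j⁆ = 0)
    (hYB : ∀ i j l, i ≠ j → i ≠ l → j ≠ l →
      ⁅δ i j, δ j l⁆ + ⁅δ i l, δ j i⁆ + ⁅δ i l, δ j l⁆ = 0) (i j : σ) :
    ⁅d i - k • ∑ l, δ i l, d j - k • ∑ l, δ j l⁆ = 0 := by
  by_cases hij : i = j
  · subst hij
    exact lie_self _
  have h₁ : ∑ l, ⁅d i, δ j l⁆ = ⁅d i, δ j i⁆ :=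
    Fintype.sum_eq_single i fun l hl => hdδ i j l hij hl.symm
  have h₂ : ∑ l, ⁅δ i l, d j⁆ = ⁅δ i j, d j⁆ :=
    Fintype.sum_eq_single j fun l hl => by
      rw [← lie_skew, hdδ j i l (Ne.symm hij) hl.symm, neg_zero]
  have h₃ : ⁅d i, δ j i⁆ + ⁅δ i j, d j⁆ = 0 := by
    rw [hδ_comm i j, lie_neg, ← lie_skew (δ i j), ← neg_add, ← add_lie, hdδ_add, neg_zero]
  have hδji : ⁅δ i j, δ j i⁆ = 0 := by rw [hδ_comm i j, lie_neg, lie_self, neg_zero]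
  have h₄ : ∀ l m, ⁅δ i l, δ j m⁆ = (if l = m then ⁅δ i l, δ j l⁆ else 0) +
      (if l = j then ⁅δ i j, δ j m⁆ else 0) + (if m = i then ⁅δ i l, δ j i⁆ else 0) := by
    intro l m
    split_ifs with a b c c b c c
    · exact absurd (c.symm.trans (a.symm.trans b)) hij
    · subst a b
      simp [hδ]
    · subst a c
      simp [hδ]
    · subst a
      simp
    · subst b c
      simp [hδji]
    · subst b
      simp
    · subst c
      simp
    · by_cases hil : i = l
      · simp [← hil, hδ]
      by_cases hjm : j = m
      · simp [← hjm, hδ]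
      simpa using hδδ i l j m hij (Ne.symm c) b a
  have h₅ : ∑ l, ∑ m, ⁅δ i l, δ j m⁆ = 0 := by
    have h₆ : ∀ l, ⁅δ i j, δ j l⁆ + ⁅δ i l, δ j i⁆ + ⁅δ i l, δ j l⁆ = 0 := by
      intro l
      by_cases hil : i = l
      · simp [← hil, hδ, hδji]
      by_cases hjl : j = l
      · simp [← hjl, hδ, hδji]
      exact hYB i j l hij hil hjl
    have h₇ := Finset.sum_congr rfl fun l (_ : l ∈ Finset.univ) => h₆ l
    simp only [Finset.sum_add_distrib, Finset.sum_const_zero] at h₇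
    rw [Finset.sum_congr rfl fun l _ => Finset.sum_congr rfl fun m _ => h₄ l m]
    simp only [Finset.sum_add_distrib, Finset.sum_ite_eq, Finset.mem_univ, if_true,
      Finset.sum_ite_eq', Finset.sum_ite_irrel, Finset.sum_const_zero]
    rw [← h₇]
    abel
  have h₈ : ⁅d i, ∑ l, δ j l⁆ + ⁅∑ l, δ i l, d j⁆ = 0 := by
    rw [lie_sum, sum_lie, h₁, h₂, h₃]
  have h₉ : ⁅∑ l, δ i l, ∑ l, δ j l⁆ = 0 := by
    rw [sum_lie_sum, h₅]
  simp only [sub_lie, lie_sub, smul_lie, lie_smul, hd, h₉, smul_zero, zero_sub, sub_zero]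
  rw [← neg_add', ← smul_add, add_comm, h₈, smul_zero, neg_zero]

section Dunkl

variable {σ R : Type*} [Fintype σ] [DecidableEq σ] [CommRing R] [IsDomain R]

/-- The rational Dunkl operator of type `A` in finitely many variables. -/
def dunkl (k : R) (i : σ) : Module.End R (MvPolynomial σ R) :=
  partialEnd i - k • ∑ j, divDiff i j

theorem dunkl_commute (k : R) (i j : σ) :
    Commute (dunkl k i : Module.End R (MvPolynomial σ R)) (dunkl k j) :=
  letI : LieRing (Module.End R (MvPolynomial σ R)) := LieRing.ofAssociativeRing
  commute_iff_lie_eq.2 <|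
    lie_dunkl_eq_zero (A := Module.End R (MvPolynomial σ R)) partialEnd divDiff k lie_partialEnd_partialEnd divDiff_self divDiff_comm
      (fun _ _ _ => lie_partialEnd_divDiff_of_ne) lie_partialEnd_add_partialEnd_divDiff
      (fun _ _ _ _ => lie_divDiff_divDiff_of_disjoint) (fun _ _ _ => lie_divDiff_yangBaxter) i j

/-- Power sums of commuting operators commute. -/
theorem sum_dunkl_pow_commute (k : R) (r s : ℕ) :
    Commute (∑ i, dunkl k i ^ r : Module.End R (MvPolynomial σ R)) (∑ i, dunkl k i ^ s) :=
  Commute.sum_left _ _ _ fun i _ => Commute.sum_right _ _ _ fun j _ =>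
    (dunkl_commute k i j).pow_pow r s

end Dunkl

section Specialization

variable (σ : Type*) [Fintype σ]

/-- The specialization of `Λ̄` to finitely many variables, `p_l ↦ ∑ x_j ^ l`. -/
def specialize : Lam →ₐ[ℂ] MvPolynomial σ ℂ :=
  MvPolynomial.aeval (MvPolynomial.psum σ ℂ)

variable {σ}

/-- The specialization of `Λ̄[x]` extending `specialize` by `x ↦ x_i`. -/
def specializeX (i : σ) : LamX →+* MvPolynomial σ ℂ :=
  Polynomial.eval₂RingHom (specialize σ).toRingHom (MvPolynomial.X i)

@[simp]
theorem specialize_X (l : ℕ) :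
    specialize σ (MvPolynomial.X l) = ∑ j, MvPolynomial.X j ^ l := by
  simp [specialize, MvPolynomial.psum]

@[simp]
theorem specializeX_C (i : σ) (f : Lam) :
    specializeX i (Polynomial.C f) = specialize σ f := by
  simp [specializeX]

@[simp]
theorem specializeX_X (i : σ) : specializeX i Polynomial.X = MvPolynomial.X i := by
  simp [specializeX]

theorem specializeX_smul (i : σ) (c : ℂ) (f : LamX) :
    specializeX i (c • f) = c • specializeX i f := by
  have h : c • f = Polynomial.C (MvPolynomial.C c) * f := by
    rw [← Polynomial.smul_eq_C_mul, ← MvPolynomial.algebraMap_eq, algebraMap_smul]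
  rw [h, map_mul, specializeX_C, MvPolynomial.smul_eq_C_mul, ← MvPolynomial.algebraMap_eq,
    ← MvPolynomial.algebraMap_eq, AlgHom.commutes]

theorem pd_add (f g : LamX) : pd (f + g) = pd f + pd g := by
  rw [pd, Polynomial.sum_add_index _ _ _ (by simp) (by intros; rw [map_add, add_mul]),
    Polynomial.derivative_add, pd, pd]
  ring

theorem Del_add (f g : LamX) : Del (f + g) = Del f + Del g :=
  Polynomial.sum_add_index _ _ _ (by simp) (by intros; rw [map_add, add_mul])

theorem E_add (f g : LamX) : E (f + g) = E f + E g :=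
  Polynomial.sum_add_index _ _ _ (by simp) (by intros; rw [add_mul])

theorem pd_monomial (n : ℕ) (c : Lam) :
    pd (Polynomial.monomial n c) =
      Polynomial.derivative (Polynomial.monomial n c) + coeffDer c * Polynomial.X ^ n := by
  rw [pd, Polynomial.sum_monomial_index _ _ (by simp)]

theorem Del_monomial (n : ℕ) (c : Lam) :
    Del (Polynomial.monomial n c) = Polynomial.C c * Dvals n := by
  rw [Del, Polynomial.sum_monomial_index _ _ (by simp)]

theorem E_monomial (n : ℕ) (c : Lam) :
    E (Polynomial.monomial n c) = c * MvPolynomial.X n := by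
  rw [E, Polynomial.sum_monomial_index _ _ (by simp)]

theorem specialize_E (f : LamX) : specialize σ (E f) = ∑ i, specializeX i f := by
  induction f using Polynomial.induction_on' with
  | add p q hp hq => simp only [E_add, map_add, hp, hq, Finset.sum_add_distrib]
  | monomial n c =>
    rw [E_monomial]
    simp only [← Polynomial.C_mul_X_pow_eq_monomial, map_mul, map_pow, specialize_X,
      specializeX_C, specializeX_X, Finset.mul_sum]

theorem specializeX_coeffDer (i : σ) (c : Lam) :
    specializeX i (coeffDer c) = MvPolynomial.pderiv i (specialize σ c) := by
  classical
  induction c using MvPolynomial.induction_on with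
  | C a =>
    rw [← MvPolynomial.algebraMap_eq, AlgHom.commutes, Derivation.map_algebraMap,
      Derivation.map_algebraMap, map_zero]
  | add p q hp hq => simp only [map_add, hp, hq]
  | mul_X p l hp =>
    have h : MvPolynomial.pderiv i (∑ j : σ, (MvPolynomial.X j ^ l : MvPolynomial σ ℂ)) =
        (l : MvPolynomial σ ℂ) * MvPolynomial.X i ^ (l - 1) := by
      simp [MvPolynomial.pderiv_X, Pi.single_apply]
    rw [Derivation.leibniz, map_mul, Derivation.leibniz, specialize_X, h, coeffDer,
      MvPolynomial.mkDerivation_X, ← coeffDer]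
    simp [Polynomial.smul_eq_C_mul, hp]

theorem specializeX_pd (i : σ) (f : LamX) :
    specializeX i (pd f) = MvPolynomial.pderiv i (specializeX i f) := by
  classical
  induction f using Polynomial.induction_on' with
  | add p q hp hq => simp only [pd_add, map_add, hp, hq]
  | monomial n c =>
    rw [pd_monomial, ← Polynomial.C_mul_X_pow_eq_monomial, map_add,
      map_mul (specializeX i) (coeffDer c), specializeX_coeffDer,
      map_mul (specializeX i) (Polynomial.C c), Derivation.leibniz]
    simp [Polynomial.derivative_X_pow]
    ring

variable [DecidableEq σ]

@[simp]
theorem transpose_specialize (i j : σ) (c : Lam) :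
    transpose i j (specialize σ c) = specialize σ c := by
  rw [← AlgHom.comp_apply]
  congr 1
  refine MvPolynomial.algHom_ext fun l => ?_
  simp [specialize, transpose]

theorem specializeX_Del (i : σ) (f : LamX) :
    specializeX i (Del f) = ∑ j, divDiff i j (specializeX i f) := by
  induction f using Polynomial.induction_on' with
  | add p q hp hq => simp only [Del_add, map_add, hp, hq, Finset.sum_add_distrib]
  | monomial n c =>
    have h : ∀ j, divDiff i j (specializeX i (Polynomial.monomial n c)) = specialize σ c *
        (∑ a ∈ Finset.range n, MvPolynomial.X i ^ (n - 1 - a) * MvPolynomial.X j ^ a -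
          if i = j then (n : MvPolynomial σ ℂ) * MvPolynomial.X i ^ (n - 1) else 0) := by
      intro j
      split_ifs with hij
      · subst hij
        have : ∀ a ∈ Finset.range n, (MvPolynomial.X i ^ (n - 1 - a) * MvPolynomial.X i ^ a :
            MvPolynomial σ ℂ) = MvPolynomial.X i ^ (n - 1) := fun a ha => by
          rw [← pow_add, Nat.sub_add_cancel (Nat.le_sub_one_of_lt (Finset.mem_range.1 ha))]
        simp [Finset.sum_congr rfl this]
      · refine divDiff_eq_of_mul_eq hij ?_
        have e := geom_sum₂_mul (MvPolynomial.X j : MvPolynomial σ ℂ) (MvPolynomial.X i) n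
        simp only [mul_comm (MvPolynomial.X j ^ _)] at e
        simp only [← Polynomial.C_mul_X_pow_eq_monomial, map_mul, map_pow, specializeX_C,
          specializeX_X, transpose_specialize, transpose_X, Equiv.swap_apply_left]
        linear_combination -specialize σ c * e
    rw [Finset.sum_congr rfl fun j _ => h j, ← Finset.mul_sum, Finset.sum_sub_distrib,
      Finset.sum_comm, Del_monomial, map_mul, specializeX_C, Dvals]
    split_ifs with hn
    · simp [hn]
    · simp only [← Finset.mul_sum]
      simp [mul_comm (MvPolynomial.X i ^ _)]

theorem specializeX_Dk (k : ℂ) (i : σ) (f : LamX) :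
    specializeX i (Dk k f) = dunkl k i (specializeX i f) := by
  rw [Dk, map_sub, specializeX_smul, specializeX_pd, specializeX_Del, dunkl, LinearMap.sub_apply,
    LinearMap.smul_apply, LinearMap.sum_apply, partialEnd_apply]

theorem specialize_Lr (k : ℂ) (r : ℕ) (f : Lam) :
    specialize σ (Lr k r f) = (∑ i, dunkl k i ^ r) (specialize σ f) := by
  rw [Lr, specialize_E, LinearMap.sum_apply]
  refine Finset.sum_congr rfl fun i _ => ?_
  rw [Module.End.pow_apply, ← specializeX_C i,
    Function.Semiconj.iterate_right (specializeX_Dk k i) r]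

end Specialization

/-- `Λ̄` embeds into the product of its specializations to finitely many variables. -/
theorem eq_of_specialize_eq {f g : Lam}
    (h : ∀ (m : ℕ) (n : Fin m → ℕ),
      specialize (Σ j, Fin (n j)) f = specialize (Σ j, Fin (n j)) g) : f = g := by
  have grid : ∀ m : ℕ,
      MvPolynomial.aeval (fun l => ∑ j : Fin m,
        (MvPolynomial.C ((j : ℂ) ^ l) * MvPolynomial.X j : MvPolynomial (Fin m) ℂ)) f =
      MvPolynomial.aeval (fun l => ∑ j : Fin m,
        (MvPolynomial.C ((j : ℂ) ^ l) * MvPolynomial.X j : MvPolynomial (Fin m) ℂ)) g := by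
    intro m
    refine MvPolynomial.funext_set (fun _ => Set.range ((↑) : ℕ → ℂ))
      (fun _ => Set.infinite_range_of_injective Nat.cast_injective) fun x hx => ?_
    choose n hn using fun j => hx j (Set.mem_univ j)
    have e := congrArg (MvPolynomial.aeval fun a : Σ j, Fin (n j) => ((a.1 : ℕ) : ℂ)) (h m n)
    have hpt : (fun l => MvPolynomial.aeval (fun a : Σ j, Fin (n j) => ((a.1 : ℕ) : ℂ))
        (MvPolynomial.psum (Σ j, Fin (n j)) ℂ l)) = fun l => MvPolynomial.aeval x (∑ j : Fin m,
        (MvPolynomial.C ((j : ℂ) ^ l) * MvPolynomial.X j : MvPolynomial (Fin m) ℂ)) := by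
      funext l
      simp [MvPolynomial.psum, Fintype.sum_sigma, ← hn, mul_comm]
    rw [specialize, MvPolynomial.comp_aeval_apply, MvPolynomial.comp_aeval_apply, hpt,
      ← MvPolynomial.comp_aeval_apply, ← MvPolynomial.comp_aeval_apply] at e
    rwa [MvPolynomial.aeval_eq_eval] at e
  refine MvPolynomial.funext fun p => ?_
  obtain ⟨m, hm⟩ : ∃ m, ∀ l ∈ f.vars ∪ g.vars, l < m :=
    ⟨(f.vars ∪ g.vars).sup id + 1, fun l hl => Nat.lt_succ_of_le (Finset.le_sup (f := id) hl)⟩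
  have hV : IsUnit (Matrix.vandermonde fun j : Fin m => (j : ℂ)).transpose := by
    rw [Matrix.isUnit_iff_isUnit_det, Matrix.det_transpose, isUnit_iff_ne_zero,
      Matrix.det_vandermonde_ne_zero_iff]
    exact fun a b hab => Fin.ext (Nat.cast_injective hab)
  obtain ⟨t, ht⟩ := Matrix.mulVec_surjective_iff_isUnit.2 hV fun l : Fin m => p l
  have key : ∀ q : Lam, q.vars ⊆ f.vars ∪ g.vars → MvPolynomial.eval p q =
      MvPolynomial.eval t (MvPolynomial.aeval (fun l => ∑ j : Fin m,
        (MvPolynomial.C ((j : ℂ) ^ l) * MvPolynomial.X j : MvPolynomial (Fin m) ℂ)) q) := by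
    intro q hq
    rw [← MvPolynomial.aeval_eq_eval, ← MvPolynomial.aeval_eq_eval,
      MvPolynomial.comp_aeval_apply]
    refine MvPolynomial.eval₂Hom_congr' rfl (fun l hl _ => ?_) rfl
    have e := congrFun ht ⟨l, hm l (hq hl)⟩
    simpa [Matrix.mulVec, dotProduct, Matrix.vandermonde] using e.symm
  rw [key f Finset.subset_union_left, key g Finset.subset_union_right, grid]

end RationalDunkl
end

/-- The rational CMS integrals at infinity commute. -/
theorem rational_CMS_integrals_at_infinity_commute (k : ℂ) (r s : ℕ)
    (hr : 1 ≤ r) (hs : 1 ≤ s) (f : Lam) :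
    Lr k r (Lr k s f) = Lr k s (Lr k r f) := by
  refine RationalDunkl.eq_of_specialize_eq fun m n => ?_
  simp only [RationalDunkl.specialize_Lr, ← Module.End.mul_apply]
  rw [(RationalDunkl.sum_dunkl_pow_commute k r s).eq]
end

section
/- The trigonometric CMS integrals at infinity commute: for all r, s ≥ 1 and all f ∈ Λ̄, L^{(r)}(L^{(s)}(f)) = L^{(s)}(L^{(r)}(f)). -/
open Polynomial MvPolynomial

noncomputable section

/-- the derivation on coefficients: p_l ↦ l·x^l -/
def coeffDerT : Derivation ℂ Lam LamX :=
  MvPolynomial.mkDerivation ℂ (fun l => (l : LamX) * Polynomial.X ^ l)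

/-- ∂ : the ℂ-derivation of Λ̄[x] with ∂x = x, ∂p_l = l x^l. -/
def pdT (f : LamX) : LamX :=
  Polynomial.X * Polynomial.derivative f
    + f.sum (fun i c => coeffDerT c * Polynomial.X ^ i)

/-- Δ(x^l) = x^l p₀ + 2x^{l−1}p₁ + ⋯ + 2x·p_{l−1} + p_l − 2l·x^l (l > 0), Δ(1) = 0. -/
def DvalsT (l : ℕ) : LamX :=
  if l = 0 then 0 else
    Polynomial.X ^ l * Polynomial.C (MvPolynomial.X 0)
      + Polynomial.C (MvPolynomial.X l)
      + 2 * (∑ j ∈ Finset.Ioo 0 l, Polynomial.X ^ (l - j) * Polynomial.C (MvPolynomial.X j))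
      - (2 * l : LamX) * Polynomial.X ^ l

/-- Δ : Λ̄-linear, Δ(x^l f) = Δ(x^l)·f. -/
def DelT (f : LamX) : LamX := f.sum (fun l c => Polynomial.C c * DvalsT l)

/-- Dunkl–Heckman operator at infinity, D_k = ∂ − (k/2)Δ. -/
def DkT (k : ℂ) (f : LamX) : LamX := pdT f - (k / 2) • DelT f

/-- the trigonometric CMS integrals at infinity L^{(r)} = E ∘ D_k^r restricted to Λ̄. -/
def LrT (k : ℂ) (r : ℕ) (f : Lam) : Lam := E ((DkT k)^[r] (Polynomial.C f))

end

noncomputable section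

namespace TrigCMS

open Equiv Finset

section Dunkl

variable {ι : Type*}

/-- The action of permutations on polynomials by renaming variables. -/
def permOp : Perm ι →* Module.End ℂ (MvPolynomial ι ℂ) where
  toFun σ := (rename σ : MvPolynomial ι ℂ →ₐ[ℂ] MvPolynomial ι ℂ).toLinearMap
  map_one' := LinearMap.ext fun f => by simp
  map_mul' σ τ := LinearMap.ext fun f => by simp [rename_rename, Function.comp_def]

theorem permOp_apply (σ : Perm ι) (f : MvPolynomial ι ℂ) : permOp σ f = rename σ f := rfl

/-- Multiplication by a variable. -/
def mulX (i : ι) : Module.End ℂ (MvPolynomial ι ℂ) := LinearMap.mulLeft ℂ (MvPolynomial.X i)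

theorem mulX_apply (i : ι) (f : MvPolynomial ι ℂ) : mulX i f = MvPolynomial.X i * f := rfl

theorem permOp_mul_mulX (σ : Perm ι) (i : ι) : permOp σ * mulX i = mulX (σ i) * permOp σ :=
  LinearMap.ext fun f => by simp [permOp_apply, mulX_apply]

theorem X_sub_X_ne_zero {i j : ι} (h : i ≠ j) :
    (MvPolynomial.X i - MvPolynomial.X j : MvPolynomial ι ℂ) ≠ 0 :=
  sub_ne_zero.mpr fun e => h (MvPolynomial.X_injective e)

variable [DecidableEq ι]

/-- The action of a transposition. -/
abbrev swapOp (i j : ι) : Module.End ℂ (MvPolynomial ι ℂ) := permOp (swap i j)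

theorem X_sub_X_dvd_sub_rename_swap (i j : ι) (f : MvPolynomial ι ℂ) :
    (MvPolynomial.X i - MvPolynomial.X j : MvPolynomial ι ℂ) ∣ f - rename (swap i j) f := by
  induction f using MvPolynomial.induction_on with
  | C a => simp
  | add p q hp hq =>
    rw [map_add, add_sub_add_comm]
    exact dvd_add hp hq
  | mul_X p l hp =>
    have hX : (MvPolynomial.X i - MvPolynomial.X j : MvPolynomial ι ℂ) ∣
        MvPolynomial.X l - MvPolynomial.X (swap i j l) := by
      rcases eq_or_ne l i with rfl | hi
      · simp
      · rcases eq_or_ne l j with rfl | hj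
        · rw [swap_apply_right]
          exact (dvd_sub_comm).mp dvd_rfl
        · simp [swap_apply_of_ne_of_ne hi hj]
    rw [map_mul, rename_X]
    have : p * MvPolynomial.X l - rename (swap i j) p * MvPolynomial.X (swap i j l)
        = (p - rename (swap i j) p) * MvPolynomial.X l
          + rename (swap i j) p * (MvPolynomial.X l - MvPolynomial.X (swap i j l)) := by ring
    rw [this]
    exact dvd_add (hp.mul_right _) (hX.mul_left _)

/-- The divided difference `(1 - s_ij) / (x_i - x_j)`, with value `0` for `i = j`. -/
def divDiff (i j : ι) : Module.End ℂ (MvPolynomial ι ℂ) :=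
  if h : i = j then 0 else
    { toFun := fun f => (X_sub_X_dvd_sub_rename_swap i j f).choose
      map_add' := fun f g => by
        apply mul_left_cancel₀ (X_sub_X_ne_zero h)
        rw [mul_add, ← (X_sub_X_dvd_sub_rename_swap i j _).choose_spec,
          ← (X_sub_X_dvd_sub_rename_swap i j _).choose_spec,
          ← (X_sub_X_dvd_sub_rename_swap i j _).choose_spec, map_add]
        ring
      map_smul' := fun c f => by
        apply mul_left_cancel₀ (X_sub_X_ne_zero h)
        rw [RingHom.id_apply, mul_smul_comm, ← (X_sub_X_dvd_sub_rename_swap i j _).choose_spec,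
          ← (X_sub_X_dvd_sub_rename_swap i j _).choose_spec, map_smul, smul_sub] }

@[simp]
theorem divDiff_self (i : ι) : divDiff i i = 0 := by simp [divDiff]

theorem X_sub_X_mul_divDiff {i j : ι} (h : i ≠ j) (f : MvPolynomial ι ℂ) :
    (MvPolynomial.X i - MvPolynomial.X j) * divDiff i j f = f - rename (swap i j) f := by
  rw [divDiff, dif_neg h]
  exact (X_sub_X_dvd_sub_rename_swap i j f).choose_spec.symm

theorem divDiff_eq {i j : ι} (h : i ≠ j) {f q : MvPolynomial ι ℂ}
    (hq : (MvPolynomial.X i - MvPolynomial.X j) * q = f - rename (swap i j) f) :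
    divDiff i j f = q :=
  mul_left_cancel₀ (X_sub_X_ne_zero h) ((X_sub_X_mul_divDiff h f).trans hq.symm)

theorem permOp_mul_divDiff (σ : Perm ι) (i j : ι) :
    permOp σ * divDiff i j = divDiff (σ i) (σ j) * permOp σ := by
  rcases eq_or_ne i j with rfl | h
  · simp
  refine LinearMap.ext fun f => (divDiff_eq (σ.injective.ne h) ?_).symm
  have e := congrArg (rename σ) (X_sub_X_mul_divDiff h f)
  simp only [map_mul, map_sub, rename_X, rename_rename] at e
  simp only [Module.End.mul_apply, permOp_apply, rename_rename]
  rw [e]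
  congr 3
  funext x
  exact (swap_apply_apply σ i j ▸ by simp : σ (swap i j x) = swap (σ i) (σ j) (σ x))

theorem permOp_mul_swapOp (σ : Perm ι) (i j : ι) :
    permOp σ * swapOp i j = swapOp (σ i) (σ j) * permOp σ := by
  rw [← map_mul, ← map_mul, swap_apply_apply]
  simp

theorem divDiff_mul_mulX_right {i j : ι} (h : i ≠ j) :
    divDiff i j * mulX j = mulX j * divDiff i j - swapOp i j := by
  refine LinearMap.ext fun f => divDiff_eq h ?_
  simp only [mulX_apply, permOp_apply, Module.End.mul_apply, LinearMap.sub_apply, map_mul,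
    rename_X, swap_apply_right]
  linear_combination (MvPolynomial.X j) * X_sub_X_mul_divDiff h f

theorem divDiff_mul_mulX_left {i j : ι} (h : i ≠ j) :
    divDiff i j * mulX i = mulX i * divDiff i j + swapOp i j := by
  refine LinearMap.ext fun f => divDiff_eq h ?_
  simp only [mulX_apply, permOp_apply, Module.End.mul_apply, LinearMap.add_apply, map_mul,
    rename_X, swap_apply_left]
  linear_combination (MvPolynomial.X i) * X_sub_X_mul_divDiff h f

theorem divDiff_mul_mulX_of_ne {i j l : ι} (hi : l ≠ i) (hj : l ≠ j) :
    divDiff i j * mulX l = mulX l * divDiff i j := by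
  rcases eq_or_ne i j with rfl | h
  · simp
  refine LinearMap.ext fun f => divDiff_eq h ?_
  simp only [mulX_apply, Module.End.mul_apply, map_mul,
    rename_X, swap_apply_of_ne_of_ne hi hj]
  linear_combination (MvPolynomial.X l) * X_sub_X_mul_divDiff h f

theorem divDiff_symm_mul (i j : ι) {F : MvPolynomial ι ℂ} (hF : F.IsSymmetric)
    (g : MvPolynomial ι ℂ) : divDiff i j (F * g) = F * divDiff i j g := by
  rcases eq_or_ne i j with rfl | h
  · simp
  · refine divDiff_eq h ?_
    rw [map_mul, hF]
    linear_combination F * X_sub_X_mul_divDiff h g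

variable [Fintype ι]

/-- The rational Dunkl operator `∂_i - k ∑_{j ≠ i} (1 - s_ij) / (x_i - x_j)`. -/
def dunkl (k : ℂ) (i : ι) : Module.End ℂ (MvPolynomial ι ℂ) :=
  (pderiv i).toLinearMap - k • ∑ j, divDiff i j

theorem permOp_mul_dunkl (k : ℂ) (σ : Perm ι) (i : ι) :
    permOp σ * dunkl k i = dunkl k (σ i) * permOp σ := by
  have h : permOp σ * (pderiv i).toLinearMap
      = (pderiv (σ i)).toLinearMap * (permOp σ : Module.End ℂ (MvPolynomial ι ℂ)) :=
    LinearMap.ext fun f => (pderiv_rename σ.injective i f).symm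
  rw [dunkl, dunkl, mul_sub, sub_mul, h, mul_smul_comm, smul_mul_assoc, mul_sum, sum_mul,
    ← Equiv.sum_comp σ fun j => divDiff (σ i) j * permOp σ]
  simp_rw [permOp_mul_divDiff]

theorem dunkl_mul_mulX_of_ne (k : ℂ) {i j : ι} (h : i ≠ j) :
    dunkl k i * mulX j = mulX j * dunkl k i + k • swapOp i j := by
  have hd : (pderiv i).toLinearMap * mulX j
      = (mulX j * (pderiv i).toLinearMap : Module.End ℂ (MvPolynomial ι ℂ)) :=
    LinearMap.ext fun f => by simp [mulX_apply, pderiv_X_of_ne h.symm]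
  have hs : (∑ l, divDiff i l) * mulX j = mulX j * ∑ l, divDiff i l - swapOp i j := by
    rw [← add_sum_erase _ _ (mem_univ j), add_mul, mul_add, divDiff_mul_mulX_right h, sum_mul,
      mul_sum, sum_congr rfl fun l hl => divDiff_mul_mulX_of_ne h.symm (ne_of_mem_erase hl).symm]
    abel
  rw [dunkl, sub_mul, mul_sub, smul_mul_assoc, mul_smul_comm, hd, hs, smul_sub]
  abel

/-- The sum of all transpositions moving `i`. -/
def transSum (i : ι) : Module.End ℂ (MvPolynomial ι ℂ) := ∑ j ∈ univ.erase i, swapOp i j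

theorem dunkl_mul_mulX_self (k : ℂ) (i : ι) :
    dunkl k i * mulX i = mulX i * dunkl k i + 1 - k • transSum i := by
  have hd : (pderiv i).toLinearMap * mulX i
      = (mulX i * (pderiv i).toLinearMap + 1 : Module.End ℂ (MvPolynomial ι ℂ)) :=
    LinearMap.ext fun f => by simp [mulX_apply]
  have hs : (∑ l, divDiff i l) * mulX i = mulX i * ∑ l, divDiff i l + transSum i := by
    rw [← add_sum_erase _ _ (mem_univ i), divDiff_self, zero_add, sum_mul,
      mul_sum, sum_congr rfl fun l hl => divDiff_mul_mulX_left (ne_of_mem_erase hl).symm,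
      sum_add_distrib, transSum]
  rw [dunkl, sub_mul, mul_sub, smul_mul_assoc, mul_smul_comm, hd, hs, smul_add]
  abel

theorem transSum_mul_dunkl (k : ℂ) {i j : ι} (h : i ≠ j) :
    transSum i * dunkl k j
      = dunkl k j * transSum i + dunkl k i * swapOp i j - swapOp i j * dunkl k i := by
  have hj : j ∈ univ.erase i := mem_erase.mpr ⟨h.symm, mem_univ j⟩
  rw [transSum, ← add_sum_erase _ _ hj, add_mul, mul_add, sum_mul, mul_sum]
  have : ∀ l ∈ (univ.erase i).erase j, swapOp i l * dunkl k j = dunkl k j * swapOp i l := by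
    intro l hl
    rw [swapOp, permOp_mul_dunkl, swap_apply_of_ne_of_ne h.symm (ne_of_mem_erase hl).symm]
  rw [sum_congr rfl this, swapOp, permOp_mul_dunkl, permOp_mul_dunkl, swap_apply_left,
    swap_apply_right]
  abel

theorem dunkl_comm (k : ℂ) (i j : ι) : dunkl k i * dunkl k j = dunkl k j * dunkl k i := by
  rcases eq_or_ne i j with rfl | hij
  · rfl
  have key : ∀ {i j : ι}, i ≠ j → (dunkl k i * dunkl k j - dunkl k j * dunkl k i) * mulX i
      = mulX i * (dunkl k i * dunkl k j - dunkl k j * dunkl k i) := by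
    intro i j h
    have h₁ : dunkl k i * dunkl k j * mulX i = mulX i * (dunkl k i * dunkl k j) + dunkl k j
        - k • (transSum i * dunkl k j) + k • (dunkl k i * swapOp i j) := by
      rw [mul_assoc, dunkl_mul_mulX_of_ne k h.symm, mul_add, ← mul_assoc, dunkl_mul_mulX_self,
        mul_smul_comm, swapOp, swap_comm j i, sub_mul, add_mul, one_mul, smul_mul_assoc, mul_assoc]
    have h₂ : dunkl k j * dunkl k i * mulX i = mulX i * (dunkl k j * dunkl k i)
        + k • (swapOp i j * dunkl k i) + dunkl k j - k • (dunkl k j * transSum i) := by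
      rw [mul_assoc, dunkl_mul_mulX_self, mul_sub, mul_add, ← mul_assoc,
        dunkl_mul_mulX_of_ne k h.symm, mul_smul_comm, swapOp, swap_comm j i, add_mul, mul_one,
        smul_mul_assoc, mul_assoc]
    rw [sub_mul, mul_sub, h₁, h₂, transSum_mul_dunkl k h, smul_sub, smul_add]
    abel
  have comm : ∀ l, (dunkl k i * dunkl k j - dunkl k j * dunkl k i) * mulX l
      = mulX l * (dunkl k i * dunkl k j - dunkl k j * dunkl k i) := by
    intro l
    rcases eq_or_ne l i with rfl | hi
    · exact key hij
    rcases eq_or_ne l j with rfl | hj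
    · have := key hij.symm
      rw [sub_mul, mul_sub] at this ⊢
      rw [← neg_sub, this, neg_sub]
    · have aux : ∀ {i j : ι}, l ≠ i → l ≠ j → dunkl k i * dunkl k j * mulX l
          = mulX l * (dunkl k i * dunkl k j) + k • (swapOp i l * dunkl k j)
            + k • (dunkl k i * swapOp j l) := by
        intro i j hi hj
        rw [mul_assoc, dunkl_mul_mulX_of_ne k hj.symm, mul_add, ← mul_assoc,
          dunkl_mul_mulX_of_ne k hi.symm, add_mul, mul_smul_comm, smul_mul_assoc, mul_assoc]
      rw [sub_mul, mul_sub, aux hi hj, aux hj hi, swapOp, swapOp, permOp_mul_dunkl,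
        permOp_mul_dunkl, swap_apply_of_ne_of_ne hij.symm hj.symm,
        swap_apply_of_ne_of_ne hij hi.symm]
      abel
  rw [← sub_eq_zero]
  refine LinearMap.ext fun f => ?_
  rw [LinearMap.zero_apply]
  induction f using MvPolynomial.induction_on with
  | C a =>
    have hC : ∀ i : ι, dunkl k i (MvPolynomial.C a) = 0 := by
      intro i
      have : ∀ l, divDiff i l (MvPolynomial.C a) = 0 := by
        intro l
        rcases eq_or_ne i l with rfl | h
        · simp
        · exact divDiff_eq h (by simp)
      simp [dunkl, this]
    simp [hC]
  | add p q hp hq => rw [map_add, hp, hq, add_zero]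
  | mul_X p l hp =>
    have := LinearMap.congr_fun (comm l) p
    rw [Module.End.mul_apply, Module.End.mul_apply, hp, map_zero, mulX_apply] at this
    rw [mul_comm, this]

/-- The operator `x_i T_i`, with `T_i` the rational Dunkl operator. -/
def eulerDunkl (k : ℂ) (i : ι) : Module.End ℂ (MvPolynomial ι ℂ) := mulX i * dunkl k i

theorem permOp_mul_eulerDunkl (k : ℂ) (σ : Perm ι) (i : ι) :
    permOp σ * eulerDunkl k i = eulerDunkl k (σ i) * permOp σ := by
  rw [eulerDunkl, ← mul_assoc, permOp_mul_mulX, mul_assoc, permOp_mul_dunkl, ← mul_assoc,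
    eulerDunkl]

theorem eulerDunkl_mul_sub (k : ℂ) {i j : ι} (h : i ≠ j) :
    eulerDunkl k i * eulerDunkl k j - eulerDunkl k j * eulerDunkl k i
      = k • ((eulerDunkl k i - eulerDunkl k j) * swapOp i j) := by
  have aux : ∀ {i j : ι}, i ≠ j → eulerDunkl k i * eulerDunkl k j
      = mulX i * mulX j * (dunkl k i * dunkl k j) + k • (eulerDunkl k i * swapOp i j) := by
    intro i j h
    rw [eulerDunkl, eulerDunkl, mul_assoc, ← mul_assoc (dunkl k i), dunkl_mul_mulX_of_ne k h,
      add_mul, smul_mul_assoc, swapOp, permOp_mul_dunkl, swap_apply_right, mul_add,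
      mul_smul_comm]
    simp only [mul_assoc]
  have hX : mulX i * mulX j = (mulX j * mulX i : Module.End ℂ (MvPolynomial ι ℂ)) :=
    LinearMap.ext fun f => mul_left_comm _ _ _
  rw [aux h, aux h.symm, hX, dunkl_comm k i j, swapOp, swapOp, swap_comm j i, sub_mul, smul_sub]
  abel

end Dunkl

section Cherednik

variable {ι : Type*} [LinearOrder ι]

theorem swap_lt_iff {a b i : ι} (h : a < i ↔ b < i) (l : ι) : swap a b l < i ↔ l < i := by
  rcases eq_or_ne l a with rfl | ha
  · rw [swap_apply_left, h]
  rcases eq_or_ne l b with rfl | hb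
  · rw [swap_apply_right, h]
  rw [swap_apply_of_ne_of_ne ha hb]

theorem swapOp_mul_self (i j : ι) : swapOp i j * swapOp i j = 1 := by
  rw [← map_mul, swap_mul_self, map_one]

variable [Fintype ι]

/-- The Jucys–Murphy element `∑_{l < i} s_il`. -/
def jucysMurphy (i : ι) : Module.End ℂ (MvPolynomial ι ℂ) := ∑ l with l < i, swapOp i l

/-- If `σ` preserves the set of indices below `i`, it intertwines the corresponding sums. -/
theorem permOp_mul_jucysMurphy (σ : Perm ι) (i : ι) (h : ∀ l, σ l < i ↔ l < i) :
    permOp σ * jucysMurphy i = (∑ l with l < i, swapOp (σ i) l) * permOp σ := by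
  rw [jucysMurphy, mul_sum, sum_mul]
  exact sum_equiv σ (by simp [h]) fun l _ => permOp_mul_swapOp σ i l

theorem permOp_mul_jucysMurphy_of_fixed (σ : Perm ι) (i : ι) (hi : σ i = i)
    (h : ∀ l, σ l < i ↔ l < i) : permOp σ * jucysMurphy i = jucysMurphy i * permOp σ := by
  rw [permOp_mul_jucysMurphy σ i h, hi, jucysMurphy]

theorem jucysMurphy_comm {i j : ι} (h : i < j) :
    jucysMurphy i * jucysMurphy j = jucysMurphy j * jucysMurphy i := by
  conv_lhs => rw [jucysMurphy]
  conv_rhs => rw [jucysMurphy.eq_def i]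
  rw [sum_mul, mul_sum]
  refine sum_congr rfl fun l hl => ?_
  have hl : l < i := (mem_filter.mp hl).2
  exact permOp_mul_jucysMurphy_of_fixed _ _
    (swap_apply_of_ne_of_ne h.ne' (hl.trans h).ne') (swap_lt_iff (by simp [h, hl.trans h]))

/-- The Cherednik operators. -/
def cherednik (k : ℂ) (i : ι) : Module.End ℂ (MvPolynomial ι ℂ) :=
  eulerDunkl k i - k • jucysMurphy i

theorem cherednik_comm_of_lt (k : ℂ) {i j : ι} (h : i < j) :
    cherednik k i * cherednik k j = cherednik k j * cherednik k i := by
  have h₁ : jucysMurphy i * eulerDunkl k j = eulerDunkl k j * jucysMurphy i := by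
    rw [jucysMurphy, sum_mul, mul_sum]
    refine sum_congr rfl fun l hl => ?_
    have hl : l < i := (mem_filter.mp hl).2
    rw [swapOp, permOp_mul_eulerDunkl, swap_apply_of_ne_of_ne h.ne' (hl.trans h).ne']
  have h₂ : eulerDunkl k i * jucysMurphy j = jucysMurphy j * eulerDunkl k i
      + (eulerDunkl k i - eulerDunkl k j) * swapOp i j := by
    have hi : i ∈ ({l | l < j} : Finset ι) := by simp [h]
    rw [jucysMurphy, ← add_sum_erase _ _ hi, mul_add, add_mul, mul_sum, sum_mul]
    have : ∀ l ∈ ({l | l < j} : Finset ι).erase i,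
        eulerDunkl k i * swapOp j l = swapOp j l * eulerDunkl k i := by
      intro l hl
      rw [swapOp, permOp_mul_eulerDunkl, swap_apply_of_ne_of_ne h.ne (ne_of_mem_erase hl).symm]
    rw [sum_congr rfl this, swapOp, permOp_mul_eulerDunkl, swap_apply_right, swapOp,
      swap_comm j i, sub_mul]
    abel
  have h₃ := eulerDunkl_mul_sub k h.ne
  rw [sub_eq_iff_eq_add] at h₃
  simp only [cherednik, sub_mul, mul_sub, smul_mul_assoc, mul_smul_comm, h₁, h₂, h₃,
    jucysMurphy_comm h, smul_add, smul_sub]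
  abel

theorem cherednik_comm (k : ℂ) (i j : ι) :
    cherednik k i * cherednik k j = cherednik k j * cherednik k i := by
  rcases lt_trichotomy i j with h | rfl | h
  · exact cherednik_comm_of_lt k h
  · rfl
  · exact (cherednik_comm_of_lt k h).symm

theorem swapOp_mul_cherednik_left (k : ℂ) {i j : ι} (h : i ⋖ j) :
    swapOp i j * cherednik k i = cherednik k j * swapOp i j + k • 1 := by
  have hJ : jucysMurphy j = swapOp i j + ∑ l with l < i, swapOp j l := by
    have : ({l | l < j} : Finset ι) = insert i ({l | l < i} : Finset ι) := by
      ext l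
      simp [h.lt_iff_le_left, le_iff_eq_or_lt]
    rw [jucysMurphy, this, sum_insert (by simp), swapOp, swap_comm]
  have hs : swapOp i j * jucysMurphy i = jucysMurphy j * swapOp i j - 1 := by
    rw [permOp_mul_jucysMurphy _ _ (swap_lt_iff (by simp [h.le])), hJ, add_mul, swapOp_mul_self,
      swap_apply_left, add_sub_cancel_left]
  rw [cherednik, cherednik, mul_sub, sub_mul, mul_smul_comm, hs, permOp_mul_eulerDunkl,
    swap_apply_left, smul_sub, smul_mul_assoc]
  abel

theorem swapOp_mul_cherednik_right (k : ℂ) {i j : ι} (h : i ⋖ j) :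
    swapOp i j * cherednik k j = cherednik k i * swapOp i j - k • 1 := by
  have := congrArg (fun P => swapOp i j * P * swapOp i j) (swapOp_mul_cherednik_left k h)
  simp only [mul_add, add_mul, mul_smul_comm, smul_mul_assoc, mul_one, swapOp_mul_self] at this
  rw [← mul_assoc, swapOp_mul_self, one_mul, ← mul_assoc, mul_assoc (_ * _), swapOp_mul_self,
    mul_one] at this
  rw [this, add_sub_cancel_right]

theorem swapOp_mul_cherednik_of_ne (k : ℂ) {i j l : ι} (h : i ⋖ j) (hi : l ≠ i) (hj : l ≠ j) :
    swapOp i j * cherednik k l = cherednik k l * swapOp i j := by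
  have hl : i < l ↔ j < l :=
    ⟨fun hil => (h.ge_of_gt hil).lt_of_ne hj.symm, h.lt.trans⟩
  rw [cherednik, mul_sub, sub_mul, mul_smul_comm, smul_mul_assoc, permOp_mul_eulerDunkl,
    permOp_mul_jucysMurphy_of_fixed _ _ (swap_apply_of_ne_of_ne hi hj) (swap_lt_iff hl),
    swap_apply_of_ne_of_ne hi hj]

/-- The algebra generated by the Cherednik operators. -/
def cherednikAlg (ι : Type*) [Fintype ι] [LinearOrder ι] (k : ℂ) :
    Subalgebra ℂ (Module.End ℂ (MvPolynomial ι ℂ)) :=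
  Algebra.adjoin ℂ (Set.range (cherednik k))

theorem cherednik_mem (k : ℂ) (i : ι) : cherednik k i ∈ cherednikAlg ι k :=
  Algebra.subset_adjoin ⟨i, rfl⟩

theorem cherednikAlg_comm {k : ℂ} {P Q : Module.End ℂ (MvPolynomial ι ℂ)}
    (hP : P ∈ cherednikAlg ι k) (hQ : Q ∈ cherednikAlg ι k) : P * Q = Q * P := by
  have := Algebra.isMulCommutative_adjoin ℂ (s := Set.range (cherednik (ι := ι) k)) (by
    rintro _ ⟨i, rfl⟩ _ ⟨j, rfl⟩
    exact cherednik_comm k i j)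
  exact congrArg Subtype.val (mul_comm' (⟨P, hP⟩ : Algebra.adjoin ℂ (Set.range (cherednik k)))
    ⟨Q, hQ⟩)

theorem exists_swapOp_mul_eq {k : ℂ} {i j : ι} (h : i ⋖ j)
    {P : Module.End ℂ (MvPolynomial ι ℂ)} (hP : P ∈ cherednikAlg ι k) :
    ∃ P₁ ∈ cherednikAlg ι k, ∃ P₂ ∈ cherednikAlg ι k, swapOp i j * P = P₁ * swapOp i j + P₂ := by
  have hc : ∀ c : ℂ, c • (1 : Module.End ℂ (MvPolynomial ι ℂ)) ∈ cherednikAlg ι k :=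
    fun c => Subalgebra.smul_mem _ (one_mem _) c
  induction hP using Algebra.adjoin_induction with
  | mem P hP =>
    obtain ⟨l, rfl⟩ := hP
    rcases eq_or_ne l i with rfl | hi
    · exact ⟨_, cherednik_mem k j, _, hc k, swapOp_mul_cherednik_left k h⟩
    rcases eq_or_ne l j with rfl | hj
    · exact ⟨_, cherednik_mem k i, _, neg_mem (hc k),
        (swapOp_mul_cherednik_right k h).trans (sub_eq_add_neg _ _)⟩
    · exact ⟨_, cherednik_mem k l, 0, zero_mem _,
        (swapOp_mul_cherednik_of_ne k h hi hj).trans (add_zero _).symm⟩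
  | algebraMap c =>
    exact ⟨_, algebraMap_mem _ c, 0, zero_mem _, by rw [add_zero, Algebra.commutes]⟩
  | add P Q _ _ hP hQ =>
    obtain ⟨P₁, hP₁, P₂, hP₂, eP⟩ := hP
    obtain ⟨Q₁, hQ₁, Q₂, hQ₂, eQ⟩ := hQ
    refine ⟨_, add_mem hP₁ hQ₁, _, add_mem hP₂ hQ₂, ?_⟩
    rw [mul_add, eP, eQ, add_mul]
    abel
  | mul P Q _ hQ hP hQ' =>
    obtain ⟨P₁, hP₁, P₂, hP₂, eP⟩ := hP
    obtain ⟨Q₁, hQ₁, Q₂, hQ₂, eQ⟩ := hQ'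
    refine ⟨_, mul_mem hP₁ hQ₁, _, add_mem (mul_mem hP₁ hQ₂) (mul_mem hP₂ hQ), ?_⟩
    rw [← mul_assoc, eP, add_mul, mul_assoc, eQ, mul_add, mul_assoc]
    abel

/-- `P` acts on symmetric polynomials as some polynomial in the Cherednik operators. -/
def ActsAsCherednik (k : ℂ) (P : Module.End ℂ (MvPolynomial ι ℂ)) : Prop :=
  ∃ Q ∈ cherednikAlg ι k, ∀ F : MvPolynomial ι ℂ, F.IsSymmetric → P F = Q F

namespace ActsAsCherednik

variable {k : ℂ} {P Q : Module.End ℂ (MvPolynomial ι ℂ)}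

theorem of_mem (h : P ∈ cherednikAlg ι k) : ActsAsCherednik k P := ⟨P, h, fun _ _ => rfl⟩

theorem add (hP : ActsAsCherednik k P) (hQ : ActsAsCherednik k Q) :
    ActsAsCherednik k (P + Q) := by
  obtain ⟨P', hP', eP⟩ := hP
  obtain ⟨Q', hQ', eQ⟩ := hQ
  exact ⟨_, add_mem hP' hQ', fun F hF => by simp [eP F hF, eQ F hF]⟩

theorem smul (c : ℂ) (hP : ActsAsCherednik k P) : ActsAsCherednik k (c • P) := by
  obtain ⟨P', hP', eP⟩ := hP
  exact ⟨_, Subalgebra.smul_mem _ hP' c, fun F hF => by simp [eP F hF]⟩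

theorem sub (hP : ActsAsCherednik k P) (hQ : ActsAsCherednik k Q) :
    ActsAsCherednik k (P - Q) := by
  obtain ⟨P', hP', eP⟩ := hP
  obtain ⟨Q', hQ', eQ⟩ := hQ
  exact ⟨_, sub_mem hP' hQ', fun F hF => by simp [eP F hF, eQ F hF]⟩

theorem sum {α : Type*} (s : Finset α) {P : α → Module.End ℂ (MvPolynomial ι ℂ)}
    (h : ∀ a ∈ s, ActsAsCherednik k (P a)) : ActsAsCherednik k (∑ a ∈ s, P a) :=
  sum_induction P _ (fun _ _ => add) (of_mem (zero_mem _)) h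

theorem cherednik_mul (i : ι) (hP : ActsAsCherednik k P) :
    ActsAsCherednik k (cherednik k i * P) := by
  obtain ⟨P', hP', eP⟩ := hP
  exact ⟨_, mul_mem (cherednik_mem k i) hP', fun F hF => by simp [eP F hF]⟩

theorem swapOp_mul {i j : ι} (h : i ⋖ j) (hP : ActsAsCherednik k P) :
    ActsAsCherednik k (swapOp i j * P) := by
  obtain ⟨P', hP', eP⟩ := hP
  obtain ⟨P₁, hP₁, P₂, hP₂, e⟩ := exists_swapOp_mul_eq h hP'
  refine ⟨_, add_mem hP₁ hP₂, fun F hF => ?_⟩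
  rw [Module.End.mul_apply, eP F hF, ← Module.End.mul_apply, e, LinearMap.add_apply,
    Module.End.mul_apply, permOp_apply, hF, LinearMap.add_apply]

theorem permOp_mul {n : ℕ} {P : Module.End ℂ (MvPolynomial (Fin n) ℂ)} (σ : Perm (Fin n))
    (hP : ActsAsCherednik k P) : ActsAsCherednik k (permOp σ * P) := by
  cases n with
  | zero => rwa [Subsingleton.elim σ 1, map_one, one_mul]
  | succ n =>
    have hσ : σ ∈ Submonoid.closure (Set.range fun i : Fin n => swap i.castSucc i.succ) := by
      rw [Perm.mclosure_swap_castSucc_succ]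
      trivial
    induction hσ using Submonoid.closure_induction generalizing P with
    | mem σ h =>
      obtain ⟨i, rfl⟩ := h
      exact hP.swapOp_mul (by simp [Fin.covBy_iff])
    | one => rwa [map_one, one_mul]
    | mul σ τ _ _ hσ hτ =>
      rw [map_mul, mul_assoc]
      exact hσ (hτ hP)

end ActsAsCherednik

end Cherednik

section Heckman

variable {ι : Type*} [Fintype ι] [DecidableEq ι]

/-- The Dunkl–Heckman operator in finitely many variables. -/
def heckman (k : ℂ) (i : ι) : Module.End ℂ (MvPolynomial ι ℂ) :=
  mulX i * (pderiv i).toLinearMap - (k / 2) • ∑ j, (mulX i + mulX j) * divDiff i j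

theorem heckman_eq (k : ℂ) (i : ι) :
    heckman k i = eulerDunkl k i + (k / 2) • ∑ j, (1 - swapOp i j) := by
  have h : ∀ j, (mulX i + mulX j) * divDiff i j
      = (2 : ℂ) • (mulX i * divDiff i j) - (1 - swapOp i j) := by
    intro j
    rcases eq_or_ne i j with rfl | hij
    · rw [swapOp, swap_self, ← Perm.one_def, map_one]
      simp
    · refine LinearMap.ext fun f => ?_
      simp only [Module.End.mul_apply, LinearMap.add_apply, LinearMap.sub_apply, mulX_apply,
        two_smul, permOp_apply, Module.End.one_apply]
      linear_combination -X_sub_X_mul_divDiff hij f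
  simp_rw [heckman, h, sum_sub_distrib, smul_sub, ← smul_sum, smul_smul, ← mul_sum]
  rw [eulerDunkl, dunkl, mul_sub, mul_smul_comm, div_mul_cancel₀ k two_ne_zero]
  abel

/-- The integrals `∑ D_i ^ r` in finitely many variables. -/
def powerSumHeckman (ι : Type*) [Fintype ι] [DecidableEq ι] (k : ℂ) (r : ℕ) :
    Module.End ℂ (MvPolynomial ι ℂ) :=
  ∑ i, heckman k i ^ r

theorem actsAsCherednik_powerSumHeckman (n : ℕ) (k : ℂ) (r : ℕ) :
    ActsAsCherednik k (powerSumHeckman (Fin n) k r) := by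
  have step : ∀ (i : Fin n) {P}, ActsAsCherednik k P → ActsAsCherednik k (heckman k i * P) := by
    intro i P hP
    have e : heckman k i * P = cherednik k i * P + k • ∑ l with l < i, permOp (swap i l) * P
        + (k / 2) • ∑ j, (P - permOp (swap i j) * P) := by
      simp only [heckman_eq, cherednik, jucysMurphy, add_mul, sub_mul, smul_mul_assoc, sum_mul,
        one_mul, sub_add_cancel]
    rw [e]
    exact ((hP.cherednik_mul i).add (.smul _ (.sum _ fun l _ => hP.permOp_mul _))).add
      (.smul _ (.sum _ fun j _ => hP.sub (hP.permOp_mul _)))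
  refine .sum _ fun i _ => ?_
  induction r with
  | zero => exact .of_mem (one_mem _)
  | succ r ih =>
    rw [pow_succ']
    exact step i ih

theorem powerSumHeckman_comm_apply {n : ℕ} (k : ℂ) (r s : ℕ) {F : MvPolynomial (Fin n) ℂ}
    (hF : F.IsSymmetric) (hr : (powerSumHeckman (Fin n) k r F).IsSymmetric)
    (hs : (powerSumHeckman (Fin n) k s F).IsSymmetric) :
    powerSumHeckman (Fin n) k r (powerSumHeckman (Fin n) k s F)
      = powerSumHeckman (Fin n) k s (powerSumHeckman (Fin n) k r F) := by
  obtain ⟨P, hP, eP⟩ := actsAsCherednik_powerSumHeckman n k r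
  obtain ⟨Q, hQ, eQ⟩ := actsAsCherednik_powerSumHeckman n k s
  rw [eP _ hs, eQ _ hr, eP F hF, eQ F hF, ← Module.End.mul_apply, ← Module.End.mul_apply,
    cherednikAlg_comm hP hQ]

end Heckman

section PowerSum

variable (ι : Type*) [Fintype ι]

/-- The map from symmetric functions to polynomials in finitely many variables sending each `p_l`
to the corresponding power sum. -/
def powerSumHom : Lam →ₐ[ℂ] MvPolynomial ι ℂ := aeval fun l => psum ι ℂ l

@[simp]
theorem powerSumHom_X (l : ℕ) : powerSumHom ι (MvPolynomial.X l) = psum ι ℂ l := aeval_X _ _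

theorem isSymmetric_powerSumHom (f : Lam) : (powerSumHom ι f).IsSymmetric := by
  intro σ
  rw [← AlgHom.comp_apply]
  congr 1
  ext l : 1
  simp [psum_isSymmetric ι ℂ l σ]

variable {ι}

/-- The extension of `powerSumHom` sending `x` to the variable `x_i`. -/
def powerSumHomX (i : ι) : LamX →+* MvPolynomial ι ℂ :=
  Polynomial.eval₂RingHom (powerSumHom ι : Lam →+* MvPolynomial ι ℂ) (MvPolynomial.X i)

@[simp]
theorem powerSumHomX_X (i : ι) : powerSumHomX i Polynomial.X = MvPolynomial.X i := by
  simp [powerSumHomX]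

@[simp]
theorem powerSumHomX_C (i : ι) (f : Lam) : powerSumHomX i (Polynomial.C f) = powerSumHom ι f := by
  simp [powerSumHomX]

theorem powerSumHomX_smul (i : ι) (c : ℂ) (f : LamX) :
    powerSumHomX i (c • f) = c • powerSumHomX i f := by
  have : c • f = Polynomial.C (MvPolynomial.C c) * f := by
    rw [← MvPolynomial.algebraMap_eq, ← Polynomial.smul_eq_C_mul, algebraMap_smul]
  rw [this, map_mul, powerSumHomX_C, ← MvPolynomial.algebraMap_eq, AlgHom.commutes,
    ← Algebra.smul_def]

theorem powerSumHomX_coeffDerT (i : ι) (c : Lam) :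
    powerSumHomX i (coeffDerT c) = MvPolynomial.X i * pderiv i (powerSumHom ι c) := by
  induction c using MvPolynomial.induction_on with
  | C a =>
    rw [← MvPolynomial.algebraMap_eq, Derivation.map_algebraMap, AlgHom.commutes,
      Derivation.map_algebraMap, map_zero, mul_zero]
  | add p q hp hq => simp only [map_add, hp, hq, mul_add]
  | mul_X p l hp =>
    have hX : MvPolynomial.X i * pderiv i (psum ι ℂ l)
        = (l : MvPolynomial ι ℂ) * MvPolynomial.X i ^ l := by
      classical
      rw [psum, map_sum, Finset.sum_eq_single i]
      · rcases l with _ | l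
        · simp
        · simp
          ring
      · intro j _ hj
        simp [pderiv_X_of_ne hj]
      · simp
    have hd : coeffDerT (MvPolynomial.X l) = (l : LamX) * Polynomial.X ^ l :=
      mkDerivation_X _ _ _
    have hsmul : ∀ (a : Lam) (b : LamX), a • b = Polynomial.C a * b :=
      fun a b => Polynomial.smul_eq_C_mul a
    rw [Derivation.leibniz, map_add, hsmul, hsmul, map_mul, map_mul, hp, hd, map_mul, map_mul,
      Derivation.leibniz, powerSumHomX_C, powerSumHomX_C, powerSumHom_X, map_natCast,
      map_pow, powerSumHomX_X, smul_eq_mul, smul_eq_mul]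
    linear_combination -powerSumHom ι p * hX

theorem powerSumHomX_pdT (i : ι) (f : LamX) :
    powerSumHomX i (pdT f) = MvPolynomial.X i * pderiv i (powerSumHomX i f) := by
  have hadd : ∀ f g : LamX, pdT (f + g) = pdT f + pdT g := by
    intro f g
    rw [pdT, pdT, pdT, Polynomial.sum_add_index f g _ (by simp) (by simp [add_mul]), map_add]
    ring
  induction f using Polynomial.induction_on' with
  | add f g hf hg => rw [hadd, map_add, hf, hg, map_add, map_add, mul_add]
  | monomial l c =>
    have hm : pdT (Polynomial.monomial l c)
        = Polynomial.C c * ((l : LamX) * Polynomial.X ^ l)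
          + coeffDerT c * Polynomial.X ^ l := by
      rw [pdT, Polynomial.sum_monomial_index _ _ (by simp), Polynomial.derivative_monomial,
        ← Polynomial.C_mul_X_pow_eq_monomial, map_mul, Polynomial.C_eq_natCast]
      rcases l with _ | l
      · simp
      · simp only [Nat.add_sub_cancel]
        ring
    have hX : MvPolynomial.X i * pderiv i (MvPolynomial.X i ^ l : MvPolynomial ι ℂ)
        = (l : MvPolynomial ι ℂ) * MvPolynomial.X i ^ l := by
      rcases l with _ | l
      · simp
      · simp
        ring
    rw [hm, ← Polynomial.C_mul_X_pow_eq_monomial]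
    simp only [map_add, map_mul, map_pow, map_natCast, powerSumHomX_C, powerSumHomX_X,
      powerSumHomX_coeffDerT, Derivation.leibniz, smul_eq_mul]
    linear_combination -powerSumHom ι c * hX

theorem powerSumHom_E (f : LamX) : powerSumHom ι (E f) = ∑ i, powerSumHomX i f := by
  induction f using Polynomial.induction_on' with
  | add f g hf hg =>
    rw [E, Polynomial.sum_add_index f g _ (by simp) (by simp [add_mul]), ← E, ← E]
    simp only [map_add, hf, hg, sum_add_distrib]
  | monomial l c =>
    rw [E, Polynomial.sum_monomial_index _ _ (by simp), ← Polynomial.C_mul_X_pow_eq_monomial]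
    simp [psum, mul_sum]

theorem sub_mul_pow_add_pow_add_sum {R : Type*} [CommRing R] (x y : R) {l : ℕ} (hl : 1 ≤ l) :
    (x - y) * (x ^ l + y ^ l + 2 * ∑ m ∈ Ioo 0 l, x ^ (l - m) * y ^ m)
      = (x + y) * (x ^ l - y ^ l) := by
  induction l, hl using Nat.le_induction with
  | base =>
    have : Ioo 0 1 = (∅ : Finset ℕ) := rfl
    rw [this, sum_empty]
    ring
  | succ l hl ih =>
    have hs : ∑ m ∈ Ioo 0 (l + 1), x ^ (l + 1 - m) * y ^ m
        = x * ∑ m ∈ Ioo 0 l, x ^ (l - m) * y ^ m + x * y ^ l := by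
      have : Ioo 0 (l + 1) = insert l (Ioo 0 l) := by
        ext m
        simp only [mem_Ioo, mem_insert]
        omega
      rw [this, sum_insert (by simp), mul_sum, Nat.add_sub_cancel_left, pow_one, add_comm]
      congr 1
      refine sum_congr rfl fun m hm => ?_
      rw [Nat.succ_sub (mem_Ioo.mp hm).2.le, pow_succ]
      ring
    rw [hs]
    linear_combination x * ih

variable [DecidableEq ι]

theorem powerSumHomX_DvalsT (i : ι) (l : ℕ) :
    powerSumHomX i (DvalsT l)
      = ∑ j, (MvPolynomial.X i + MvPolynomial.X j) * divDiff i j (MvPolynomial.X i ^ l) := by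
  rcases Nat.eq_zero_or_pos l with rfl | hl
  · have : ∀ j, divDiff i j (1 : MvPolynomial ι ℂ) = 0 := by
      intro j
      rcases eq_or_ne i j with rfl | h
      · simp
      · exact divDiff_eq h (by simp)
    simp [DvalsT, this]
  set w : ι → MvPolynomial ι ℂ := fun j => MvPolynomial.X i ^ l + MvPolynomial.X j ^ l
    + 2 * ∑ m ∈ Ioo 0 l, MvPolynomial.X i ^ (l - m) * MvPolynomial.X j ^ m with hw
  have h : ∀ j ∈ univ.erase i,
      (MvPolynomial.X i + MvPolynomial.X j) * divDiff i j (MvPolynomial.X i ^ l) = w j := by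
    intro j hj
    have hij := (ne_of_mem_erase hj).symm
    apply mul_left_cancel₀ (X_sub_X_ne_zero hij)
    rw [hw, sub_mul_pow_add_pow_add_sum _ _ hl, mul_left_comm, X_sub_X_mul_divDiff hij, map_pow,
      rename_X, swap_apply_left]
  have hi : w i = 2 * (l : MvPolynomial ι ℂ) * MvPolynomial.X i ^ l := by
    have : ∀ m ∈ Ioo 0 l, (MvPolynomial.X i ^ (l - m) * MvPolynomial.X i ^ m : MvPolynomial ι ℂ)
        = MvPolynomial.X i ^ l := by
      intro m hm
      rw [← pow_add, Nat.sub_add_cancel (mem_Ioo.mp hm).2.le]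
    rw [hw]
    dsimp only
    rw [sum_congr rfl this, sum_const, Nat.card_Ioo, nsmul_eq_mul, Nat.sub_zero,
      Nat.cast_sub hl, Nat.cast_one]
    ring
  rw [← add_sum_erase _ _ (mem_univ i), divDiff_self, LinearMap.zero_apply, mul_zero, zero_add,
    sum_congr rfl h, ← add_sub_cancel_left (w i) (∑ j ∈ univ.erase i, w j),
    add_sum_erase _ _ (mem_univ i), hi, hw, DvalsT, if_neg hl.ne']
  simp only [map_sub, map_add, map_mul, map_sum, map_pow, map_natCast, map_ofNat, powerSumHomX_C,
    powerSumHomX_X, powerSumHom_X, psum, sum_add_distrib, ← mul_sum, pow_zero]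
  rw [sum_comm]
  simp only [← mul_sum, sum_const, nsmul_eq_mul]
  ring

theorem powerSumHomX_DelT (i : ι) (f : LamX) :
    powerSumHomX i (DelT f)
      = ∑ j, (MvPolynomial.X i + MvPolynomial.X j) * divDiff i j (powerSumHomX i f) := by
  induction f using Polynomial.induction_on' with
  | add f g hf hg =>
    rw [DelT, Polynomial.sum_add_index f g _ (by simp) (by simp [add_mul]), ← DelT, ← DelT]
    simp only [map_add, hf, hg, mul_add, sum_add_distrib]
  | monomial l c =>
    rw [DelT, Polynomial.sum_monomial_index _ _ (by simp), map_mul, powerSumHomX_DvalsT,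
      ← Polynomial.C_mul_X_pow_eq_monomial, map_mul, map_pow, powerSumHomX_C, powerSumHomX_X]
    simp only [divDiff_symm_mul _ _ (isSymmetric_powerSumHom ι c), mul_sum, mul_left_comm]

theorem powerSumHomX_DkT (k : ℂ) (i : ι) (f : LamX) :
    powerSumHomX i (DkT k f) = heckman k i (powerSumHomX i f) := by
  rw [DkT, map_sub, powerSumHomX_smul, powerSumHomX_pdT, powerSumHomX_DelT]
  simp [heckman, mulX_apply, add_mul]

theorem powerSumHom_LrT (k : ℂ) (r : ℕ) (f : Lam) :
    powerSumHom ι (LrT k r f) = powerSumHeckman ι k r (powerSumHom ι f) := by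
  have h : ∀ i : ι, powerSumHomX i ((DkT k)^[r] (Polynomial.C f))
      = (heckman k i ^ r) (powerSumHom ι f) := by
    intro i
    rw [Function.Semiconj.iterate_right (f := powerSumHomX i) (powerSumHomX_DkT k i) r,
      powerSumHomX_C, Module.End.pow_apply]
  simp [LrT, powerSumHom_E, h, powerSumHeckman]

end PowerSum

theorem eval_aeval_eq {σ τ : Type*} (x : τ → ℂ) (g : σ → MvPolynomial τ ℂ)
    (f : MvPolynomial σ ℂ) :
    MvPolynomial.eval x (aeval g f) = MvPolynomial.eval (fun l => MvPolynomial.eval x (g l)) f := by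
  induction f using MvPolynomial.induction_on with
  | C a => simp [MvPolynomial.algebraMap_eq]
  | add p q hp hq => simp only [map_add, hp, hq]
  | mul_X p l hp => rw [map_mul, map_mul, map_mul, hp, MvPolynomial.aeval_X, MvPolynomial.eval_X]

/-- A symmetric function vanishing in every finite number of variables is zero. -/
theorem eq_zero_of_powerSumHom_eq_zero {f : Lam} (h : ∀ n, powerSumHom (Fin n) f = 0) : f = 0 := by
  obtain ⟨M, hM⟩ : ∃ M, ∀ l ∈ f.vars, l < M :=
    ⟨f.vars.sup id + 1, fun l hl => Nat.lt_succ_of_le (le_sup (f := id) hl)⟩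
  set a : Fin M → ℂ := fun j => (j : ℕ) with ha
  have ha_inj : Function.Injective a := fun i j hij => Fin.ext (Nat.cast_injective hij)
  have hmult : ∀ v : Fin M → ℕ, MvPolynomial.eval (fun l => ∑ j, (v j : ℂ) * a j ^ l) f = 0 := by
    intro v
    have e := Fintype.equivFin (Σ j, Fin (v j))
    have := eval_aeval_eq (fun i => a (e.symm i).1) (psum _ ℂ) f
    rw [← powerSumHom, h, map_zero] at this
    rw [this]
    congr 2
    funext l
    simp only [psum, map_sum, map_pow, MvPolynomial.eval_X]
    rw [Equiv.sum_comp e.symm fun t => a t.1 ^ l, Fintype.sum_sigma]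
    simp
  set q : MvPolynomial (Fin M) ℂ :=
    aeval (fun l => ∑ j, MvPolynomial.C (a j ^ l) * MvPolynomial.X j) f with hq
  have heval : ∀ u : Fin M → ℂ, MvPolynomial.eval u q
      = MvPolynomial.eval (fun l => ∑ j, u j * a j ^ l) f := by
    intro u
    rw [hq, eval_aeval_eq]
    simp [mul_comm]
  have hq0 : q = 0 := by
    refine MvPolynomial.funext_set (fun _ => Set.range ((↑) : ℕ → ℂ))
      (fun _ => Set.infinite_range_of_injective Nat.cast_injective) fun x hx => ?_
    choose v hv using fun j => hx j trivial
    rw [heval, map_zero, ← hmult v]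
    simp only [hv]
  refine MvPolynomial.funext fun z => ?_
  have hdet : IsUnit (Matrix.vandermonde a).det :=
    isUnit_iff_ne_zero.mpr (Matrix.det_vandermonde_ne_zero_iff.mpr ha_inj)
  set u : Fin M → ℂ := Matrix.vecMul (fun l : Fin M => z l) (Matrix.vandermonde a)⁻¹ with hu
  have huz : ∀ l : Fin M, ∑ j, u j * a j ^ (l : ℕ) = z l := by
    intro l
    have : Matrix.vecMul u (Matrix.vandermonde a) = fun l : Fin M => z l := by
      rw [hu, Matrix.vecMul_vecMul, Matrix.nonsing_inv_mul _ hdet, Matrix.vecMul_one]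
    exact congrFun this l
  have := heval u
  rw [hq0, map_zero] at this
  rw [map_zero, this]
  refine MvPolynomial.eval₂Hom_congr' rfl (fun l hl _ => ?_) rfl
  exact (huz ⟨l, hM l hl⟩).symm

end TrigCMS

end

/-- the trigonometric CMS integrals at infinity commute. -/
theorem trig_CMS_integrals_at_infinity_commute (k : ℂ) (r s : ℕ)
    (hr : 1 ≤ r) (hs : 1 ≤ s) (f : Lam) :
    LrT k r (LrT k s f) = LrT k s (LrT k r f) := by
  rw [← sub_eq_zero]
  refine TrigCMS.eq_zero_of_powerSumHom_eq_zero fun n => ?_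
  have h := fun t g => TrigCMS.powerSumHom_LrT (ι := Fin n) k t g
  rw [map_sub, sub_eq_zero, h, h, h, h]
  refine TrigCMS.powerSumHeckman_comm_apply k r s (TrigCMS.isSymmetric_powerSumHom _ f) ?_ ?_ <;>
    rw [← h] <;> exact TrigCMS.isSymmetric_powerSumHom _ _
end

section
/- For every f ∈ Λ̄, E(D_k²(f)) = (Σ_{a,b>0} p_{a+b} ∂_a ∂_b − k Σ_{a,b>0} p_a p_b ∂_{a+b} + (1+k) Σ_{a>0} a·p_a ∂_a − k·p₀·Σ_{a>0} p_a ∂_a)(f), where ∂_a = a·∂/∂p_a; i.e., the second trigonometric CMS integral at infinity L^{(2)} coincides with the trigonometric CMS operator at infinity. -/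
open Polynomial MvPolynomial

noncomputable section

/-- `E` as a `Λ̄`-linear map. -/
def ELin : LamX →ₗ[Lam] Lam :=
  Polynomial.lsum fun l => LinearMap.mulRight Lam (MvPolynomial.X l : Lam)

lemma E_eq_ELin (g : LamX) : E g = ELin g := by
  simp [E, ELin, Polynomial.lsum_apply]

lemma ELin_C_mul_X_pow (c : Lam) (l : ℕ) :
    ELin (Polynomial.C c * Polynomial.X ^ l) = c * MvPolynomial.X l := by
  rw [← E_eq_ELin, E, Polynomial.C_mul_X_pow_eq_monomial, Polynomial.sum_monomial_index _ _ (by simp)]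

lemma ELin_C_mul (c : Lam) (g : LamX) : ELin (Polynomial.C c * g) = c * ELin g := by
  rw [← Polynomial.smul_eq_C_mul, map_smul, smul_eq_mul]

lemma ELin_X_pow_mul_C (c : Lam) (l : ℕ) :
    ELin (Polynomial.X ^ l * Polynomial.C c) = c * MvPolynomial.X l := by
  rw [mul_comm, ELin_C_mul_X_pow]

lemma ELin_C (c : Lam) : ELin (Polynomial.C c) = c * MvPolynomial.X 0 := by
  simpa using ELin_C_mul_X_pow c 0

lemma coeff_coeffDerT (f : Lam) (n : ℕ) :
    (coeffDerT f).coeff n = (n : ℂ) • pderiv n f := by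
  have h : (Polynomial.lcoeff Lam n).compDer coeffDerT = (n : ℂ) • pderiv n := by
    refine MvPolynomial.derivation_ext fun i => ?_
    change (coeffDerT (MvPolynomial.X i)).coeff n = (n : ℂ) • pderiv n (MvPolynomial.X i)
    rw [coeffDerT, MvPolynomial.mkDerivation_X, pderiv_X, ← Polynomial.C_eq_natCast,
      Polynomial.coeff_C_mul, Polynomial.coeff_X_pow]
    by_cases hi : n = i
    · subst hi
      simp [MvPolynomial.smul_eq_C_mul]
    · simp [hi, Ne.symm hi]
  exact DFunLike.congr_fun h f

lemma pderiv_comm {σ R : Type*} [CommRing R] (i j : σ) (f : MvPolynomial σ R) :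
    pderiv i (pderiv j f) = pderiv j (pderiv i f) := by
  classical
  have h : ⁅pderiv (R := R) i, pderiv (R := R) j⁆ = 0 := by
    refine MvPolynomial.derivation_ext fun l => ?_
    rw [Derivation.commutator_apply, pderiv_X, pderiv_X, Pi.single_apply, Pi.single_apply]
    split_ifs <;> simp
  have hf := DFunLike.congr_fun h f
  rwa [Derivation.commutator_apply, Derivation.zero_apply, sub_eq_zero] at hf

lemma finsum_eq_sum_range_of_forall_ge {M : Type*} [AddCommMonoid M] {F : ℕ → M} {N : ℕ}
    (h : ∀ a, N ≤ a → F a = 0) : ∑ᶠ a, F a = ∑ a ∈ Finset.range N, F a := by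
  refine finsum_eq_sum_of_support_subset F fun a ha => ?_
  by_contra hN
  exact ha (h a (by simpa using hN))

lemma finsum_succ_eq_sum_range {M : Type*} [AddCommMonoid M] {F : ℕ → M} {N : ℕ}
    (h : ∀ a, N ≤ a → F a = 0) (h0 : F 0 = 0) :
    ∑ᶠ a, F (a + 1) = ∑ a ∈ Finset.range N, F a := by
  rw [finsum_eq_sum_range_of_forall_ge (N := N) fun a ha => h _ (by lia)]
  have h1 := Finset.sum_range_succ' F N
  rw [Finset.sum_range_succ, h N le_rfl, h0, add_zero, add_zero] at h1
  exact h1.symm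

lemma ELin_mul_X_pow (g : LamX) (i : ℕ) {N : ℕ} (hN : g.natDegree < N) :
    ELin (g * Polynomial.X ^ i) =
      ∑ m ∈ Finset.range N, g.coeff m * MvPolynomial.X (m + i) := by
  conv_lhs => rw [g.as_sum_range' N hN]
  simp_rw [Finset.sum_mul, map_sum, ← Polynomial.C_mul_X_pow_eq_monomial, mul_assoc, ← pow_add,
    ELin_C_mul_X_pow]

lemma ELin_coeffDerT_mul_X_pow (c : Lam) (i : ℕ) :
    ELin (coeffDerT c * Polynomial.X ^ i) =
      ∑ᶠ b : ℕ, MvPolynomial.X (i + (b + 1)) * ((((b + 1) : ℕ) : ℂ) • pderiv (b + 1) c) := by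
  rw [ELin_mul_X_pow _ i (Nat.lt_succ_self _),
    ← finsum_succ_eq_sum_range (F := fun m => (coeffDerT c).coeff m * MvPolynomial.X (m + i))]
  · refine finsum_congr fun b => ?_
    rw [coeff_coeffDerT, mul_comm, add_comm i]
  · intro a ha
    rw [Polynomial.coeff_eq_zero_of_natDegree_lt ha, zero_mul]
  · simp [coeff_coeffDerT]

lemma ELin_DvalsT {l : ℕ} (hl : l ≠ 0) :
    ELin (DvalsT l) = 2 * (MvPolynomial.X 0 * MvPolynomial.X l)
      + 2 * ∑ j ∈ Finset.Ioo 0 l, MvPolynomial.X (l - j) * MvPolynomial.X j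
      - 2 * ((l : ℂ) • MvPolynomial.X l) := by
  have h2 : (2 : LamX) = Polynomial.C 2 := (map_ofNat Polynomial.C 2).symm
  have hl' : (l : LamX) = Polynomial.C (l : Lam) := by simp
  rw [DvalsT, if_neg hl, h2, hl', ← Polynomial.C_mul, map_sub, map_add, map_add, ELin_C_mul,
    map_sum, ELin_C, ELin_C_mul_X_pow, ELin_X_pow_mul_C]
  simp_rw [ELin_X_pow_mul_C, MvPolynomial.smul_eq_C_mul, map_natCast,
    mul_comm (MvPolynomial.X (l - _) : Lam)]
  ring

lemma DkT_C (k : ℂ) (f : Lam) : DkT k (Polynomial.C f) = coeffDerT f := by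
  simp [DkT, pdT, DelT, DvalsT, Polynomial.sum_C_index]

lemma ELin_pdT (g : LamX) {N : ℕ} (hN : g.natDegree < N) :
    ELin (pdT g) = ∑ l ∈ Finset.range N, ((l : ℂ) • (MvPolynomial.X l * g.coeff l)
      + ELin (coeffDerT (g.coeff l) * Polynomial.X ^ l)) := by
  rw [pdT, map_add, Finset.sum_add_distrib, g.sum_over_range' (by simp) N hN, map_sum]
  congr 1
  conv_lhs => rw [g.as_sum_range' N hN]
  simp_rw [Polynomial.derivative_sum, Finset.mul_sum, map_sum]
  refine Finset.sum_congr rfl fun l _ => ?_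
  rw [Polynomial.derivative_monomial, ← Polynomial.C_mul_X_pow_eq_monomial]
  rcases l with - | l
  · simp
  · rw [Nat.add_sub_cancel, mul_left_comm, ← pow_succ', ELin_C_mul_X_pow,
      MvPolynomial.smul_eq_C_mul, map_natCast]
    ring

lemma ELin_DelT (g : LamX) {N : ℕ} (hN : g.natDegree < N) (h0 : g.coeff 0 = 0) :
    ELin (DelT g) = ∑ l ∈ Finset.range N, g.coeff l *
      (2 * (MvPolynomial.X 0 * MvPolynomial.X l)
      + 2 * ∑ j ∈ Finset.Ioo 0 l, MvPolynomial.X (l - j) * MvPolynomial.X j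
      - 2 * ((l : ℂ) • MvPolynomial.X l)) := by
  rw [DelT, g.sum_over_range' (by simp) N hN, map_sum]
  refine Finset.sum_congr rfl fun l _ => ?_
  rw [ELin_C_mul]
  rcases eq_or_ne l 0 with rfl | hl
  · simp [h0]
  · rw [ELin_DvalsT hl]

lemma finsum_finsum_eq_sum_Ioo {M : Type*} [AddCommMonoid M] (G : ℕ → ℕ → M) {N : ℕ}
    (h : ∀ a b, N ≤ a + b → G a b = 0) :
    ∑ᶠ a : ℕ, ∑ᶠ b : ℕ, G (a + 1) (b + 1) =
      ∑ l ∈ Finset.range N, ∑ j ∈ Finset.Ioo 0 l, G (l - j) j := by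
  have h1 (a : ℕ) :
      ∑ᶠ b : ℕ, G (a + 1) (b + 1) = ∑ b ∈ Finset.range N, G (a + 1) (b + 1) :=
    finsum_eq_sum_range_of_forall_ge fun b hb => h _ _ (by lia)
  simp_rw [h1]
  rw [finsum_eq_sum_range_of_forall_ge (N := N)
    fun a ha => Finset.sum_eq_zero fun b _ => h _ _ (by lia), Finset.sum_sigma',
    Finset.sum_sigma']
  symm
  refine Finset.sum_of_injOn (fun x => ⟨x.1 - x.2 - 1, x.2 - 1⟩) ?_ ?_ ?_ ?_
  · rintro ⟨l, j⟩ hx ⟨l', j'⟩ hy hxy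
    simp only [Finset.coe_sigma, Set.mem_sigma_iff, Finset.mem_coe, Finset.mem_range,
      Finset.mem_Ioo, Sigma.mk.injEq, heq_eq_eq] at hx hy hxy ⊢
    lia
  · rintro ⟨l, j⟩ hx
    simp only [Finset.coe_sigma, Set.mem_sigma_iff, Finset.mem_coe, Finset.mem_range,
      Finset.mem_Ioo] at hx ⊢
    lia
  · rintro ⟨a, b⟩ - hab
    refine h _ _ ?_
    by_contra! hN
    refine hab ⟨⟨a + 1 + (b + 1), b + 1⟩, ?_, ?_⟩
    · simp only [Finset.coe_sigma, Set.mem_sigma_iff, Finset.mem_coe, Finset.mem_range,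
        Finset.mem_Ioo]
      lia
    · simp
  · rintro ⟨l, j⟩ hx
    simp only [Finset.mem_sigma, Finset.mem_range, Finset.mem_Ioo] at hx
    congr 1 <;> lia

end

/-- the second trigonometric CMS integral at infinity coincides with the
trigonometric CMS operator at infinity:
L^{(2)} = Σ_{a,b>0} p_{a+b} ∂_a∂_b − k Σ_{a,b>0} p_a p_b ∂_{a+b}
          + (1+k) Σ_{a>0} a p_a ∂_a − k p₀ Σ_{a>0} p_a ∂_a,   ∂_a = a ∂/∂p_a.
(Sums over a,b > 0 are written with indices shifted to run over all naturals;
`∑ᶠ` is the sum of a finitely supported family.) -/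
theorem trig_CMS_operator_at_infinity (k : ℂ) (f : Lam) :
    E (DkT k (DkT k (Polynomial.C f))) =
      (∑ᶠ a : ℕ, ∑ᶠ b : ℕ, MvPolynomial.X ((a+1) + (b+1)) *
          ((((a+1) : ℕ) : ℂ) • (((b+1) : ℕ) : ℂ) • pderiv (a+1) (pderiv (b+1) f)))
      - k • (∑ᶠ a : ℕ, ∑ᶠ b : ℕ, MvPolynomial.X (a+1) * MvPolynomial.X (b+1) *
          ((((a+1)+(b+1) : ℕ) : ℂ) • pderiv ((a+1)+(b+1)) f))
      + (1 + k) • (∑ᶠ a : ℕ, (((a+1 : ℕ) : ℂ)) •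
          (MvPolynomial.X (a+1) * ((((a+1) : ℕ) : ℂ) • pderiv (a+1) f)))
      - k • (MvPolynomial.X 0 * ∑ᶠ a : ℕ,
          MvPolynomial.X (a+1) * ((((a+1) : ℕ) : ℂ) • pderiv (a+1) f)) := by
  set g : LamX := coeffDerT f
  have hc (n : ℕ) : g.coeff n = (n : ℂ) • pderiv n f := coeff_coeffDerT f n
  have h0 : g.coeff 0 = 0 := by simp [hc]
  obtain ⟨N, hN⟩ : ∃ N, g.natDegree < N := ⟨_, Nat.lt_succ_self _⟩
  have hz (n : ℕ) (hn : N ≤ n) : g.coeff n = 0 :=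
    Polynomial.coeff_eq_zero_of_natDegree_lt (hN.trans_le hn)
  have h1 (a : ℕ) : (∑ᶠ b : ℕ, (MvPolynomial.X ((a+1) + (b+1)) : Lam) *
      ((((a+1) : ℕ) : ℂ) • (((b+1) : ℕ) : ℂ) • pderiv (a+1) (pderiv (b+1) f))) =
      ELin (coeffDerT (g.coeff (a + 1)) * Polynomial.X ^ (a + 1)) := by
    rw [ELin_coeffDerT_mul_X_pow]
    refine finsum_congr fun b => ?_
    rw [hc, Derivation.map_smul, pderiv_comm,
      smul_comm (((a + 1 : ℕ) : ℂ))]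
  have h2 := finsum_finsum_eq_sum_Ioo (N := N)
    (fun a b => (MvPolynomial.X a * MvPolynomial.X b * g.coeff (a + b) : Lam))
    fun a b hab => by rw [hz _ hab, mul_zero]
  simp_rw [h1, ← hc]
  rw [h2, DkT_C, E_eq_ELin, DkT, map_sub, LinearMap.map_smul_of_tower, ELin_pdT g hN,
    ELin_DelT g hN h0,
    finsum_succ_eq_sum_range (N := N)
      (F := fun a => ELin (coeffDerT (g.coeff a) * Polynomial.X ^ a))
      (fun a ha => by simp [hz a ha]) (by simp [h0]),
    finsum_succ_eq_sum_range (N := N)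
      (F := fun a => (a : ℂ) • (MvPolynomial.X a * g.coeff a : Lam))
      (fun a ha => by simp [hz a ha]) (by simp),
    finsum_succ_eq_sum_range (N := N)
      (F := fun a => (MvPolynomial.X a * g.coeff a : Lam))
      (fun a ha => by simp [hz a ha]) (by simp [h0])]
  simp_rw [Finset.mul_sum, Finset.smul_sum, ← Finset.sum_sub_distrib, ← Finset.sum_add_distrib,
    ← Finset.sum_sub_distrib]
  refine Finset.sum_congr rfl fun l _ => ?_
  have h3 : ∑ j ∈ Finset.Ioo 0 l,
        (k • (MvPolynomial.X (l - j) * MvPolynomial.X j * g.coeff (l - j + j)) : Lam) =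
      k • (g.coeff l * ∑ j ∈ Finset.Ioo 0 l, MvPolynomial.X (l - j) * MvPolynomial.X j) := by
    rw [Finset.mul_sum, Finset.smul_sum]
    refine Finset.sum_congr rfl fun j hj => ?_
    rw [Nat.sub_add_cancel (Finset.mem_Ioo.1 hj).2.le, mul_comm (g.coeff l)]
  have h4 : (MvPolynomial.C (k / 2) * 2 : Lam) = MvPolynomial.C k := by
    rw [← map_ofNat MvPolynomial.C 2, ← map_mul, div_mul_cancel₀ k two_ne_zero]
  rw [h3]
  simp only [← Finset.mul_sum, MvPolynomial.smul_eq_C_mul, map_add, map_one, ← h4]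
  ring
end

section
/- The B-type rational CMS integrals at infinity commute: for all r, s ≥ 1 and all f ∈ Λ̄, L^{(r)}(L^{(s)}(f)) = L^{(s)}(L^{(r)}(f)), where L^{(r)}(f) = E(D^{2r}(f)). -/
open Polynomial MvPolynomial

noncomputable section

/-- the derivation on coefficients: p_l ↦ 2l·x^{2l−1} -/
def coeffDerB : Derivation ℂ Lam LamX :=
  MvPolynomial.mkDerivation ℂ (fun l => ((2 * l : ℕ) : LamX) * Polynomial.X ^ (2 * l - 1))

/-- ∂ : the ℂ-derivation of Λ̄[x] with ∂x = 1, ∂p_l = 2l·x^{2l−1}. -/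
def pdB (f : LamX) : LamX :=
  Polynomial.derivative f + f.sum (fun i c => coeffDerB c * Polynomial.X ^ i)

/-- Δ(x^l) for the B-type operator:
Δ(x^{2l}) = x^{2l−1}p₀ + x^{2l−3}p₁ + ⋯ + x·p_{l−1} − l·x^{2l−1},
Δ(x^{2l−1}) = x^{2l−2}p₀ + x^{2l−4}p₁ + ⋯ + p_{l−1} − l·x^{2l−2}  (l > 0), Δ(1) = 0;
uniformly, Δ(x^a) = Σ_{j<⌈a/2⌉} x^{a−1−2j} p_j − ⌈a/2⌉·x^{a−1} for a > 0. -/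
def DvalsB (a : ℕ) : LamX :=
  if a = 0 then 0 else
    (∑ j ∈ Finset.range ((a + 1) / 2),
        Polynomial.X ^ (a - 1 - 2 * j) * Polynomial.C (MvPolynomial.X j))
      - (((a + 1) / 2 : ℕ) : LamX) * Polynomial.X ^ (a - 1)

/-- Δ : Λ̄-linear, Δ(x^l f) = Δ(x^l)·f. -/
def DelB (f : LamX) : LamX := f.sum (fun l c => Polynomial.C c * DvalsB l)

/-- the Λ̄-linear map (q/x)(1−τ) : x^l ↦ q(x^{l−1} − (−1)^l x^{l−1}). -/
def qopB (q : ℂ) (f : LamX) : LamX :=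
  f.sum (fun l c => Polynomial.C c *
    (q • (Polynomial.X ^ (l - 1) - ((-1 : ℂ) ^ l) • Polynomial.X ^ (l - 1))))

/-- the B-type rational Dunkl operator at infinity D = ∂ − 2kΔ − (q/x)(1−τ). -/
def DopB (k q : ℂ) (f : LamX) : LamX := pdB f - (2 * k) • DelB f - qopB q f

/-- E : Λ̄[x] → Λ̄, x^{2l} f ↦ p_l f, x^{2l+1} f ↦ 0. -/
def EB (f : LamX) : Lam :=
  f.sum (fun i c => if Even i then c * MvPolynomial.X (i / 2) else 0)

/-- the B-type rational CMS integrals at infinity L^{(r)} = E ∘ D^{2r} on Λ̄. -/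
def LrB (k q : ℂ) (r : ℕ) (f : Lam) : Lam := EB ((DopB k q)^[2 * r] (Polynomial.C f))

end

noncomputable section

namespace BDunkl

section DividedDifference

variable {ι : Type} {a b : MvPolynomial ι ℂ}
  {s t : MvPolynomial ι ℂ →ₐ[ℂ] MvPolynomial ι ℂ}

theorem dvd_sub_algHom (h : ∀ n, a ∣ MvPolynomial.X n - s (MvPolynomial.X n))
    (f : MvPolynomial ι ℂ) : a ∣ f - s f := by
  induction f using MvPolynomial.induction_on with
  | C c =>
    rw [show s (MvPolynomial.C c) = MvPolynomial.C c from s.commutes c, sub_self]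
    exact dvd_zero a
  | add f g hf hg =>
    rw [map_add, add_sub_add_comm]
    exact dvd_add hf hg
  | mul_X f n hf =>
    have e : f * MvPolynomial.X n - s (f * MvPolynomial.X n) =
        f * (MvPolynomial.X n - s (MvPolynomial.X n)) + (f - s f) * s (MvPolynomial.X n) := by
      rw [map_mul]; ring
    rw [e]
    exact dvd_add ((h n).mul_left _) (hf.mul_right _)

open Classical in
/-- The divided difference `f ↦ (f - s f) / a`, with value `0` if `a` does not always divide
`f - s f`. -/
def divDiff (a : MvPolynomial ι ℂ) (s : MvPolynomial ι ℂ →ₐ[ℂ] MvPolynomial ι ℂ) :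
    MvPolynomial ι ℂ →ₗ[ℂ] MvPolynomial ι ℂ :=
  if h : ∃ L : MvPolynomial ι ℂ →ₗ[ℂ] MvPolynomial ι ℂ, ∀ f, a * L f = f - s f then h.choose
  else 0

/-- The quotients `(f - s f) / a` exist. -/
def IsDivisor (a : MvPolynomial ι ℂ) (s : MvPolynomial ι ℂ →ₐ[ℂ] MvPolynomial ι ℂ) : Prop :=
  a ≠ 0 ∧ ∀ n, a ∣ MvPolynomial.X n - s (MvPolynomial.X n)

theorem IsDivisor.mul_divDiff (h : IsDivisor a s) (f : MvPolynomial ι ℂ) :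
    a * divDiff a s f = f - s f := by
  have hex : ∃ L : MvPolynomial ι ℂ →ₗ[ℂ] MvPolynomial ι ℂ, ∀ f, a * L f = f - s f := by
    choose L hL using dvd_sub_algHom h.2
    refine ⟨{ toFun := L, map_add' := fun f g => ?_, map_smul' := fun c f => ?_ },
      fun f => (hL f).symm⟩
    · apply mul_left_cancel₀ h.1
      rw [mul_add, ← hL, ← hL, ← hL, map_add]; ring
    · apply mul_left_cancel₀ h.1
      rw [RingHom.id_apply, mul_smul_comm, ← hL, ← hL, map_smul, smul_sub]
  rw [divDiff, dif_pos hex]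
  exact hex.choose_spec f

theorem IsDivisor.divDiff_one (h : IsDivisor a s) : divDiff a s 1 = 0 := by
  apply mul_left_cancel₀ h.1
  rw [h.mul_divDiff, map_one, sub_self, mul_zero]

theorem IsDivisor.divDiff_mul_of_fixed (h : IsDivisor a s) {c : MvPolynomial ι ℂ} (hc : s c = c)
    (f : MvPolynomial ι ℂ) : divDiff a s (c * f) = c * divDiff a s f := by
  apply mul_left_cancel₀ h.1
  rw [mul_left_comm, h.mul_divDiff, h.mul_divDiff, map_mul, hc, mul_sub]

theorem IsDivisor.divDiff_mul (h : IsDivisor a s) {c : MvPolynomial ι ℂ} {d : ℤ}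
    (hc : c - s c = d * a) (f : MvPolynomial ι ℂ) :
    divDiff a s (c * f) = c * divDiff a s f + d * s f := by
  apply mul_left_cancel₀ h.1
  rw [mul_add, mul_left_comm, h.mul_divDiff, h.mul_divDiff, map_mul]
  linear_combination (s f) * hc

theorem intUnit_mul_self (d : ℤˣ) :
    ((d : ℤ) : MvPolynomial ι ℂ) * ((d : ℤ) : MvPolynomial ι ℂ) = 1 := by
  rw [← Int.cast_mul, Int.units_coe_mul_self, Int.cast_one]

theorem map_divDiff (ha : IsDivisor a s) (hb : IsDivisor b t)
    {g : MvPolynomial ι ℂ →ₐ[ℂ] MvPolynomial ι ℂ} {d : ℤˣ} (hg : g a = ((d : ℤ) : _) * b)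
    (hst : ∀ f, g (s f) = t (g f)) (f : MvPolynomial ι ℂ) :
    g (divDiff a s f) = ((d : ℤ) : MvPolynomial ι ℂ) * divDiff b t (g f) := by
  apply mul_left_cancel₀ hb.1
  have h := congrArg g (ha.mul_divDiff f)
  rw [map_mul, hg, map_sub, hst] at h
  have h' := hb.mul_divDiff (g f)
  linear_combination ((d : ℤ) : MvPolynomial ι ℂ) * (h - h') - b * g (divDiff a s f) * intUnit_mul_self d

end DividedDifference

section Reflections

variable {ι : Type}

/-- The substitution `x_n ↦ ε_n x_{π n}`. -/
def signedPerm (π : Equiv.Perm ι) (ε : ι → ℤˣ) :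
    MvPolynomial ι ℂ →ₐ[ℂ] MvPolynomial ι ℂ :=
  MvPolynomial.aeval fun n => ((ε n : ℤ) : MvPolynomial ι ℂ) * MvPolynomial.X (π n)

@[simp]
theorem signedPerm_X (π : Equiv.Perm ι) (ε : ι → ℤˣ) (n : ι) :
    signedPerm π ε (MvPolynomial.X n) =
      ((ε n : ℤ) : MvPolynomial ι ℂ) * MvPolynomial.X (π n) := by
  simp [signedPerm]

/-- The linear form defining `reflection i j η`. -/
def root (i j : ι) (η : ℤˣ) : MvPolynomial ι ℂ :=
  MvPolynomial.X i - ((η : ℤ) : MvPolynomial ι ℂ) * MvPolynomial.X j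

theorem signedPerm_root (π : Equiv.Perm ι) (ε : ι → ℤˣ) (i j : ι) (η : ℤˣ) :
    signedPerm π ε (root i j η) =
      ((ε i : ℤ) : MvPolynomial ι ℂ) * root (π i) (π j) (η * (ε i * ε j)) := by
  simp only [root, map_sub, map_mul, map_intCast, signedPerm_X, Units.val_mul, Int.cast_mul]
  linear_combination -((η : ℤ) : MvPolynomial ι ℂ) * ((ε j : ℤ) : MvPolynomial ι ℂ) *
    MvPolynomial.X (π j) * (- intUnit_mul_self (ι := ι) (ε i))

theorem sum_intUnits (g : ℤˣ → MvPolynomial ι ℂ) : ∑ η : ℤˣ, g η = g 1 + g (-1) := by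
  rw [show (Finset.univ : Finset ℤˣ) = {1, -1} from rfl, Finset.sum_pair (by decide)]

theorem sum_intUnits_mul (g : ℤˣ → MvPolynomial ι ℂ) :
    ∑ η : ℤˣ, ((η : ℤ) : MvPolynomial ι ℂ) * g η = g 1 - g (-1) := by
  rw [sum_intUnits]
  push_cast
  ring

variable [DecidableEq ι]

/-- The reflection exchanging `x_i` with `η x_j`. -/
def reflection (i j : ι) (η : ℤˣ) : MvPolynomial ι ℂ →ₐ[ℂ] MvPolynomial ι ℂ :=
  signedPerm (Equiv.swap i j) fun n => if n = i ∨ n = j then η else 1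

/-- The reflection `x_i ↦ -x_i`. -/
def signFlip (i : ι) : MvPolynomial ι ℂ →ₐ[ℂ] MvPolynomial ι ℂ :=
  signedPerm 1 fun n => if n = i then -1 else 1

@[simp]
theorem reflection_X_left (i j : ι) (η : ℤˣ) :
    reflection i j η (MvPolynomial.X i) = ((η : ℤ) : MvPolynomial ι ℂ) * MvPolynomial.X j := by
  simp [reflection]

@[simp]
theorem reflection_X_right (i j : ι) (η : ℤˣ) :
    reflection i j η (MvPolynomial.X j) = ((η : ℤ) : MvPolynomial ι ℂ) * MvPolynomial.X i := by
  simp [reflection]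

theorem reflection_X_of_ne {i j n : ι} (hi : n ≠ i) (hj : n ≠ j) (η : ℤˣ) :
    reflection i j η (MvPolynomial.X n) = MvPolynomial.X n := by
  simp [reflection, hi, hj, Equiv.swap_apply_of_ne_of_ne]

theorem reflection_comm (i j : ι) (η : ℤˣ) : reflection i j η = reflection j i η := by
  simp only [reflection, Equiv.swap_comm i j, or_comm]

@[simp]
theorem signFlip_X_self (i : ι) : signFlip i (MvPolynomial.X i) = -MvPolynomial.X i := by
  simp [signFlip]

theorem signFlip_X_of_ne {i n : ι} (h : n ≠ i) :
    signFlip i (MvPolynomial.X n) = MvPolynomial.X n := by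
  simp [signFlip, h]

theorem isDivisor_root {i j : ι} (h : i ≠ j) (η : ℤˣ) :
    IsDivisor (root i j η) (reflection i j η) := by
  refine ⟨fun h0 => ?_, fun n => ?_⟩
  · have := congrArg (MvPolynomial.eval fun n => if n = i then (1 : ℂ) else 0) h0
    simp [root, h.symm] at this
  · by_cases hi : n = i
    · subst hi
      rw [reflection_X_left]
      exact dvd_rfl
    · by_cases hj : n = j
      · subst hj
        rw [reflection_X_right]
        refine ⟨-((η : ℤ) : MvPolynomial ι ℂ), ?_⟩
        rw [root]
        linear_combination -MvPolynomial.X n * intUnit_mul_self (ι := ι) η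
      · rw [reflection_X_of_ne hi hj, sub_self]
        exact dvd_zero _

theorem isDivisor_X (i : ι) : IsDivisor (MvPolynomial.X i) (signFlip i) := by
  refine ⟨MvPolynomial.X_ne_zero i, fun n => ?_⟩
  by_cases hi : n = i
  · subst hi
    rw [signFlip_X_self]
    exact ⟨2, by ring⟩
  · rw [signFlip_X_of_ne hi, sub_self]
    exact dvd_zero _

theorem signedPerm_reflection (π : Equiv.Perm ι) (ε : ι → ℤˣ) {i j : ι} (h : i ≠ j) (η : ℤˣ)
    (f : MvPolynomial ι ℂ) :
    signedPerm π ε (reflection i j η f) =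
      reflection (π i) (π j) (η * (ε i * ε j)) (signedPerm π ε f) := by
  suffices e : (signedPerm π ε).comp (reflection i j η) =
      (reflection (π i) (π j) (η * (ε i * ε j))).comp (signedPerm π ε) from
    DFunLike.congr_fun e f
  refine MvPolynomial.algHom_ext fun n => ?_
  simp only [AlgHom.comp_apply]
  by_cases hi : n = i
  · subst hi
    simp only [map_mul, map_intCast, signedPerm_X, reflection_X_left, Units.val_mul,
      Int.cast_mul]
    linear_combination -((η : ℤ) : MvPolynomial ι ℂ) * ((ε j : ℤ) : MvPolynomial ι ℂ) *
      MvPolynomial.X (π j) * (intUnit_mul_self (ι := ι) (ε n))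
  · by_cases hj : n = j
    · subst hj
      simp only [map_mul, map_intCast, signedPerm_X, reflection_X_right, Units.val_mul,
        Int.cast_mul]
      linear_combination -((η : ℤ) : MvPolynomial ι ℂ) * ((ε i : ℤ) : MvPolynomial ι ℂ) *
        MvPolynomial.X (π i) * (intUnit_mul_self (ι := ι) (ε n))
    · rw [reflection_X_of_ne hi hj, signedPerm_X, map_mul, map_intCast,
        reflection_X_of_ne (π.injective.ne hi) (π.injective.ne hj)]

theorem signedPerm_signFlip (π : Equiv.Perm ι) (ε : ι → ℤˣ) (i : ι) (f : MvPolynomial ι ℂ) :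
    signedPerm π ε (signFlip i f) = signFlip (π i) (signedPerm π ε f) := by
  suffices e : (signedPerm π ε).comp (signFlip i) = (signFlip (π i)).comp (signedPerm π ε) from
    DFunLike.congr_fun e f
  refine MvPolynomial.algHom_ext fun n => ?_
  simp only [AlgHom.comp_apply]
  by_cases hi : n = i
  · subst hi
    simp
  · rw [signFlip_X_of_ne hi, signedPerm_X, map_mul, map_intCast,
      signFlip_X_of_ne (π.injective.ne hi)]

theorem signedPerm_pderiv (π : Equiv.Perm ι) (ε : ι → ℤˣ) (i : ι) (f : MvPolynomial ι ℂ) :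
    signedPerm π ε (MvPolynomial.pderiv i f) =
      ((ε i : ℤ) : MvPolynomial ι ℂ) * MvPolynomial.pderiv (π i) (signedPerm π ε f) := by
  induction f using MvPolynomial.induction_on with
  | C c => simp [signedPerm]
  | add f g hf hg => simp only [map_add, hf, hg, mul_add]
  | mul_X f n hf =>
    have hε : MvPolynomial.pderiv (π i) ((ε n : ℤ) : MvPolynomial ι ℂ) = 0 :=
      Derivation.map_intCast _ _
    simp only [Derivation.leibniz, map_mul, map_add, smul_eq_mul, hf, signedPerm_X,
      MvPolynomial.pderiv_X, hε]
    by_cases hi : n = i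
    · subst hi
      simp only [Pi.single_eq_same, map_one]
      linear_combination -(signedPerm π ε f) * (intUnit_mul_self (ι := ι) (ε n))
    · rw [Pi.single_eq_of_ne hi, Pi.single_eq_of_ne (π.injective.ne hi), map_zero]
      ring

theorem sum_divDiff_X_pow {i j : ι} (h : i ≠ j) (l : ℕ) :
    ∑ η : ℤˣ, divDiff (root i j η) (reflection i j η) (MvPolynomial.X i ^ l) =
      2 * ∑ m ∈ Finset.range ((l + 1) / 2),
        MvPolynomial.X i ^ (l - 1 - 2 * m) * MvPolynomial.X j ^ (2 * m) := by
  have h1 := isDivisor_root h 1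
  have h2 := isDivisor_root h (-1)
  have e1 := h1.mul_divDiff (MvPolynomial.X i ^ l)
  have e2 := h2.mul_divDiff (MvPolynomial.X i ^ l)
  have hg : ∀ n : ℕ, (∑ m ∈ Finset.range n, (MvPolynomial.X j ^ 2 : MvPolynomial ι ℂ) ^ m *
      (MvPolynomial.X i ^ 2) ^ (n - 1 - m)) * (MvPolynomial.X j ^ 2 - MvPolynomial.X i ^ 2) =
      (MvPolynomial.X j ^ 2) ^ n - (MvPolynomial.X i ^ 2) ^ n :=
    fun n => (Commute.all _ _).geom_sum₂_mul n
  apply mul_left_cancel₀ (mul_ne_zero h1.1 h2.1)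
  rw [sum_intUnits]
  simp only [map_pow, reflection_X_left, root, Units.val_one, Int.cast_one, one_mul,
    Units.val_neg, Int.cast_neg, neg_mul, sub_neg_eq_add] at e1 e2 ⊢
  obtain ⟨n, rfl | rfl⟩ := l.even_or_odd'
  · have hs : ∑ m ∈ Finset.range ((2 * n + 1) / 2),
        (MvPolynomial.X i : MvPolynomial ι ℂ) ^ (2 * n - 1 - 2 * m) *
          MvPolynomial.X j ^ (2 * m) =
        MvPolynomial.X i * ∑ m ∈ Finset.range n, (MvPolynomial.X j ^ 2) ^ m *
          (MvPolynomial.X i ^ 2) ^ (n - 1 - m) := by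
      rw [show (2 * n + 1) / 2 = n by omega, Finset.mul_sum]
      refine Finset.sum_congr rfl fun m hm => ?_
      have := Finset.mem_range.1 hm
      rw [show 2 * n - 1 - 2 * m = 2 * (n - 1 - m) + 1 by omega]
      ring
    have hn := hg n
    rw [(even_two_mul n).neg_pow] at e2
    simp only [← pow_mul] at hn
    rw [hs]
    simp only [← pow_mul]
    linear_combination (MvPolynomial.X i + MvPolynomial.X j) * e1 +
      (MvPolynomial.X i - MvPolynomial.X j) * e2 + 2 * MvPolynomial.X i * hn
  · have hs : ∑ m ∈ Finset.range ((2 * n + 1 + 1) / 2),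
        (MvPolynomial.X i : MvPolynomial ι ℂ) ^ (2 * n + 1 - 1 - 2 * m) *
          MvPolynomial.X j ^ (2 * m) =
        ∑ m ∈ Finset.range (n + 1), (MvPolynomial.X j ^ 2) ^ m *
          (MvPolynomial.X i ^ 2) ^ (n + 1 - 1 - m) := by
      rw [show (2 * n + 1 + 1) / 2 = n + 1 by omega]
      refine Finset.sum_congr rfl fun m hm => ?_
      have := Finset.mem_range.1 hm
      rw [show 2 * n + 1 - 1 - 2 * m = 2 * (n + 1 - 1 - m) by omega]
      ring
    have hn := hg (n + 1)
    rw [(odd_two_mul_add_one n).neg_pow] at e2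
    rw [hs]
    simp only [← pow_mul] at hn ⊢
    linear_combination (MvPolynomial.X i + MvPolynomial.X j) * e1 +
      (MvPolynomial.X i - MvPolynomial.X j) * e2 + 2 * hn

theorem divDiff_signFlip_X_pow (i : ι) (l : ℕ) :
    divDiff (MvPolynomial.X i) (signFlip i) (MvPolynomial.X i ^ l) =
      MvPolynomial.X i ^ (l - 1) - (-1) ^ l * MvPolynomial.X i ^ (l - 1) := by
  apply mul_left_cancel₀ (isDivisor_X i).1
  rw [(isDivisor_X i).mul_divDiff, map_pow, signFlip_X_self, neg_pow]
  cases l with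
  | zero => simp
  | succ l => rw [Nat.add_sub_cancel]; ring

end Reflections

section Dunkl

variable {ι : Type} [Fintype ι] [DecidableEq ι] (k q : ℂ)

/-- The Dunkl operators of type `B` in the variables indexed by `ι`. -/
def dunkl (i : ι) : Module.End ℂ (MvPolynomial ι ℂ) :=
  (MvPolynomial.pderiv i : Derivation ℂ _ (MvPolynomial ι ℂ)).toLinearMap
    - k • ∑ j ∈ Finset.univ.erase i, ∑ η : ℤˣ, divDiff (root i j η) (reflection i j η)
    - q • divDiff (MvPolynomial.X i) (signFlip i)

theorem dunkl_apply (i : ι) (f : MvPolynomial ι ℂ) :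
    dunkl k q i f = MvPolynomial.pderiv i f
      - k • ∑ j ∈ Finset.univ.erase i, ∑ η : ℤˣ, divDiff (root i j η) (reflection i j η) f
      - q • divDiff (MvPolynomial.X i) (signFlip i) f := by
  simp [dunkl, LinearMap.sum_apply]

theorem signedPerm_dunkl (π : Equiv.Perm ι) (ε : ι → ℤˣ) (i : ι) (f : MvPolynomial ι ℂ) :
    signedPerm π ε (dunkl k q i f) =
      ((ε i : ℤ) : MvPolynomial ι ℂ) * dunkl k q (π i) (signedPerm π ε f) := by
  have hA : ∀ j ∈ Finset.univ.erase i,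
      signedPerm π ε (∑ η : ℤˣ, divDiff (root i j η) (reflection i j η) f) =
      ((ε i : ℤ) : MvPolynomial ι ℂ) * ∑ η : ℤˣ,
        divDiff (root (π i) (π j) η) (reflection (π i) (π j) η) (signedPerm π ε f) := by
    intro j hj
    have hij : i ≠ j := (Finset.ne_of_mem_erase hj).symm
    rw [map_sum, Finset.mul_sum]
    refine Fintype.sum_equiv (Equiv.mulRight (ε i * ε j)) _ _ fun η => ?_
    exact map_divDiff (isDivisor_root hij η) (isDivisor_root (π.injective.ne hij) _)
      (signedPerm_root π ε i j η) (signedPerm_reflection π ε hij η) f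
  have hT := map_divDiff (isDivisor_X i) (isDivisor_X (π i)) (signedPerm_X π ε i)
    (signedPerm_signFlip π ε i) f
  have hS : ∑ j ∈ Finset.univ.erase (π i), ∑ η : ℤˣ,
        divDiff (root (π i) j η) (reflection (π i) j η) (signedPerm π ε f) =
      ∑ j ∈ Finset.univ.erase i, ∑ η : ℤˣ,
        divDiff (root (π i) (π j) η) (reflection (π i) (π j) η) (signedPerm π ε f) := by
    symm
    refine Finset.sum_equiv π (fun j => ?_) fun j _ => rfl
    simp
  rw [dunkl_apply, dunkl_apply, map_sub, map_sub, map_smul, map_smul, map_sum,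
    signedPerm_pderiv, hT, Finset.sum_congr rfl hA, ← Finset.mul_sum, hS, mul_sub, mul_sub,
    mul_smul_comm, mul_smul_comm]

theorem reflection_dunkl_left (i j : ι) (η : ℤˣ) (f : MvPolynomial ι ℂ) :
    reflection i j η (dunkl k q i f) =
      ((η : ℤ) : MvPolynomial ι ℂ) * dunkl k q j (reflection i j η f) := by
  rw [reflection, signedPerm_dunkl]
  simp

theorem reflection_dunkl_right (i j : ι) (η : ℤˣ) (f : MvPolynomial ι ℂ) :
    reflection i j η (dunkl k q j f) =
      ((η : ℤ) : MvPolynomial ι ℂ) * dunkl k q i (reflection i j η f) := by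
  rw [reflection, signedPerm_dunkl]
  simp

theorem reflection_dunkl_of_ne {i j n : ι} (hi : n ≠ i) (hj : n ≠ j) (η : ℤˣ)
    (f : MvPolynomial ι ℂ) :
    reflection i j η (dunkl k q n f) = dunkl k q n (reflection i j η f) := by
  rw [reflection, signedPerm_dunkl]
  simp [hi, hj, Equiv.swap_apply_of_ne_of_ne]

theorem signFlip_dunkl_self (i : ι) (f : MvPolynomial ι ℂ) :
    signFlip i (dunkl k q i f) = -dunkl k q i (signFlip i f) := by
  rw [signFlip, signedPerm_dunkl]
  simp

theorem signFlip_dunkl_of_ne {i n : ι} (h : n ≠ i) (f : MvPolynomial ι ℂ) :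
    signFlip i (dunkl k q n f) = dunkl k q n (signFlip i f) := by
  rw [signFlip, signedPerm_dunkl]
  simp [h]

theorem dunkl_one (i : ι) : dunkl k q i 1 = 0 := by
  rw [dunkl_apply, (isDivisor_X i).divDiff_one, Finset.sum_eq_zero]
  · simp
  · intro j hj
    exact Finset.sum_eq_zero fun η _ =>
      (isDivisor_root (Finset.ne_of_mem_erase hj).symm η).divDiff_one

theorem dunkl_X_mul_self (i : ι) (f : MvPolynomial ι ℂ) :
    dunkl k q i (MvPolynomial.X i * f) = MvPolynomial.X i * dunkl k q i f + f
      - k • ∑ j ∈ Finset.univ.erase i, ∑ η : ℤˣ, reflection i j η f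
      - (2 * q) • signFlip i f := by
  have hA : ∀ j ∈ Finset.univ.erase i,
      ∑ η : ℤˣ, divDiff (root i j η) (reflection i j η) (MvPolynomial.X i * f) =
        MvPolynomial.X i * ∑ η : ℤˣ, divDiff (root i j η) (reflection i j η) f
          + ∑ η : ℤˣ, reflection i j η f := by
    intro j hj
    rw [Finset.mul_sum, ← Finset.sum_add_distrib]
    refine Finset.sum_congr rfl fun η _ => ?_
    rw [(isDivisor_root (Finset.ne_of_mem_erase hj).symm η).divDiff_mul (d := 1)
      (by rw [reflection_X_left, root]; simp)]
    simp
  have hT : divDiff (MvPolynomial.X i) (signFlip i) (MvPolynomial.X i * f) =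
      MvPolynomial.X i * divDiff (MvPolynomial.X i) (signFlip i) f + 2 * signFlip i f := by
    rw [(isDivisor_X i).divDiff_mul (d := 2) (by rw [signFlip_X_self]; push_cast; ring)]
    simp
  rw [dunkl_apply, dunkl_apply, Finset.sum_congr rfl hA, hT, Finset.sum_add_distrib,
    ← Finset.mul_sum, Derivation.leibniz, MvPolynomial.pderiv_X_self]
  simp only [smul_eq_mul, MvPolynomial.smul_eq_C_mul, map_mul, map_ofNat]
  ring

theorem dunkl_X_mul_of_ne {i l : ι} (h : l ≠ i) (f : MvPolynomial ι ℂ) :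
    dunkl k q i (MvPolynomial.X l * f) = MvPolynomial.X l * dunkl k q i f
      + k • ∑ η : ℤˣ, ((η : ℤ) : MvPolynomial ι ℂ) * reflection i l η f := by
  have hA : ∀ j ∈ Finset.univ.erase i,
      ∑ η : ℤˣ, divDiff (root i j η) (reflection i j η) (MvPolynomial.X l * f) =
        MvPolynomial.X l * ∑ η : ℤˣ, divDiff (root i j η) (reflection i j η) f
          - if j = l then ∑ η : ℤˣ, ((η : ℤ) : MvPolynomial ι ℂ) * reflection i l η f
            else 0 := by
    intro j hj
    have hij := (Finset.ne_of_mem_erase hj).symm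
    split_ifs with hjl
    · subst hjl
      rw [Finset.mul_sum, ← Finset.sum_sub_distrib]
      refine Finset.sum_congr rfl fun η _ => ?_
      rw [(isDivisor_root hij η).divDiff_mul (d := -(η : ℤ))]
      · push_cast; ring
      · rw [reflection_X_right, root]
        push_cast
        linear_combination -MvPolynomial.X j * intUnit_mul_self (ι := ι) η
    · rw [Finset.mul_sum, sub_zero]
      refine Finset.sum_congr rfl fun η _ => ?_
      rw [(isDivisor_root hij η).divDiff_mul_of_fixed
        (reflection_X_of_ne h (Ne.symm hjl) η)]
  have hT : divDiff (MvPolynomial.X i) (signFlip i) (MvPolynomial.X l * f) =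
      MvPolynomial.X l * divDiff (MvPolynomial.X i) (signFlip i) f :=
    (isDivisor_X i).divDiff_mul_of_fixed (signFlip_X_of_ne h) f
  rw [dunkl_apply, dunkl_apply, Finset.sum_congr rfl hA, hT, Finset.sum_sub_distrib,
    ← Finset.mul_sum, Finset.sum_ite_eq', if_pos (Finset.mem_erase.2 ⟨h, Finset.mem_univ _⟩),
    Derivation.leibniz, MvPolynomial.pderiv_X_of_ne h]
  simp only [smul_eq_mul, MvPolynomial.smul_eq_C_mul]
  ring

theorem dunkl_dunkl_X_mul_left {i j : ι} (h : i ≠ j) (f : MvPolynomial ι ℂ) :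
    dunkl k q i (dunkl k q j (MvPolynomial.X i * f))
        - dunkl k q j (dunkl k q i (MvPolynomial.X i * f)) =
      MvPolynomial.X i * (dunkl k q i (dunkl k q j f) - dunkl k q j (dunkl k q i f)) := by
  have hS : ∑ m ∈ Finset.univ.erase i, ∑ η : ℤˣ, reflection i m η (dunkl k q j f)
        - ∑ m ∈ Finset.univ.erase i, ∑ η : ℤˣ, dunkl k q j (reflection i m η f) =
      dunkl k q i (reflection i j 1 f) - dunkl k q i (reflection i j (-1) f)
        - dunkl k q j (reflection i j 1 f) - dunkl k q j (reflection i j (-1) f) := by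
    rw [← Finset.sum_sub_distrib, Finset.sum_eq_single j]
    · rw [sum_intUnits, sum_intUnits, reflection_dunkl_right, reflection_dunkl_right]
      push_cast
      ring
    · intro m hm hmj
      simp only [reflection_dunkl_of_ne k q h.symm (Ne.symm hmj), sub_self]
    · intro hj
      exact absurd (Finset.mem_erase.2 ⟨h.symm, Finset.mem_univ j⟩) hj
  rw [dunkl_X_mul_self, dunkl_X_mul_of_ne k q h]
  simp only [map_add, map_sub, map_smul, map_sum, ← zsmul_eq_mul, map_zsmul]
  rw [dunkl_X_mul_self, dunkl_X_mul_of_ne k q h]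
  simp only [zsmul_eq_mul, sum_intUnits_mul, reflection_comm j i,
    reflection_dunkl_left, signFlip_dunkl_of_ne k q h.symm]
  push_cast
  simp only [MvPolynomial.smul_eq_C_mul]
  linear_combination -MvPolynomial.C k * hS

theorem dunkl_dunkl_X_mul {i j : ι} (h : i ≠ j) (l : ι) (f : MvPolynomial ι ℂ) :
    dunkl k q i (dunkl k q j (MvPolynomial.X l * f))
        - dunkl k q j (dunkl k q i (MvPolynomial.X l * f)) =
      MvPolynomial.X l * (dunkl k q i (dunkl k q j f) - dunkl k q j (dunkl k q i f)) := by
  by_cases hi : l = i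
  · subst hi
    exact dunkl_dunkl_X_mul_left k q h f
  by_cases hj : l = j
  · subst hj
    linear_combination -dunkl_dunkl_X_mul_left k q h.symm f
  rw [dunkl_X_mul_of_ne k q hi, dunkl_X_mul_of_ne k q hj]
  simp only [map_add, map_smul, map_sum, ← zsmul_eq_mul, map_zsmul]
  rw [dunkl_X_mul_of_ne k q hi, dunkl_X_mul_of_ne k q hj]
  simp only [← zsmul_eq_mul, reflection_dunkl_of_ne k q h (Ne.symm hi),
    reflection_dunkl_of_ne k q h.symm (Ne.symm hj)]
  ring

theorem commute_dunkl (i j : ι) : Commute (dunkl k q i) (dunkl k q j) := by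
  by_cases h : i = j
  · rw [h]
  refine LinearMap.ext fun f => sub_eq_zero.1 ?_
  rw [Module.End.mul_apply, Module.End.mul_apply]
  induction f using MvPolynomial.induction_on with
  | C c =>
    rw [show (MvPolynomial.C c : MvPolynomial ι ℂ) = c • 1 by
      rw [MvPolynomial.smul_eq_C_mul, mul_one]]
    simp only [map_smul, dunkl_one, map_zero, smul_zero, sub_self]
  | add f g hf hg =>
    simp only [map_add]
    rw [add_sub_add_comm, hf, hg, add_zero]
  | mul_X f n hf => rw [mul_comm, dunkl_dunkl_X_mul k q h, hf, mul_zero]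

end Dunkl

section Realization

variable {ι : Type} [Fintype ι]

/-- The homomorphism `Λ̄ → ℂ[x_i : i ∈ ι]` sending `p_l` to `∑ i, x_i ^ (2 l)`. -/
def realize (ι : Type) [Fintype ι] : Lam →ₐ[ℂ] MvPolynomial ι ℂ :=
  MvPolynomial.aeval fun l => ∑ i : ι, MvPolynomial.X i ^ (2 * l)

@[simp]
theorem realize_X (l : ℕ) :
    realize ι (MvPolynomial.X l) = ∑ i : ι, MvPolynomial.X i ^ (2 * l) := by
  simp [realize]

/-- The extension of `realize ι` to `Λ̄[x]` sending `x` to `x_i`. -/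
def realizeAt (i : ι) : LamX →+* MvPolynomial ι ℂ :=
  Polynomial.eval₂RingHom (realize ι : Lam →+* MvPolynomial ι ℂ) (MvPolynomial.X i)

@[simp]
theorem realizeAt_X (i : ι) : realizeAt i Polynomial.X = MvPolynomial.X i := by
  simp [realizeAt]

@[simp]
theorem realizeAt_C (i : ι) (c : Lam) : realizeAt i (Polynomial.C c) = realize ι c := by
  simp [realizeAt]

@[simp]
theorem realizeAt_monomial (i : ι) (l : ℕ) (c : Lam) :
    realizeAt i (Polynomial.monomial l c) = realize ι c * MvPolynomial.X i ^ l := by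
  simp [realizeAt]

theorem realizeAt_smul (i : ι) (c : ℂ) (F : LamX) :
    realizeAt i (c • F) = c • realizeAt i F := by
  rw [← algebraMap_smul Lam c F, Polynomial.smul_eq_C_mul, map_mul, realizeAt_C,
    AlgHom.commutes, Algebra.smul_def]

theorem signedPerm_realize (π : Equiv.Perm ι) (ε : ι → ℤˣ) (c : Lam) :
    signedPerm π ε (realize ι c) = realize ι c := by
  suffices e : (signedPerm π ε).comp (realize ι) = realize ι from DFunLike.congr_fun e c
  refine MvPolynomial.algHom_ext fun l => ?_
  simp only [AlgHom.comp_apply, realize_X, map_sum, map_pow, signedPerm_X]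
  refine Fintype.sum_equiv π _ _ fun i => ?_
  rw [mul_pow, pow_mul, pow_two, intUnit_mul_self, one_pow, one_mul]

variable [DecidableEq ι]

theorem realizeAt_coeffDerB (i : ι) (c : Lam) :
    realizeAt i (coeffDerB c) = MvPolynomial.pderiv i (realize ι c) := by
  induction c using MvPolynomial.induction_on with
  | C c =>
    rw [show (MvPolynomial.C c : Lam) = algebraMap ℂ Lam c from rfl, Derivation.map_algebraMap,
      AlgHom.commutes, Derivation.map_algebraMap, map_zero]
  | add f g hf hg => simp only [map_add, hf, hg]
  | mul_X f l hf =>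
    have hX : realizeAt i (coeffDerB (MvPolynomial.X l)) =
        MvPolynomial.pderiv i (realize ι (MvPolynomial.X l)) := by
      rw [coeffDerB, MvPolynomial.mkDerivation_X, realize_X, map_sum, Finset.sum_eq_single i]
      · rw [Derivation.leibniz_pow, MvPolynomial.pderiv_X_self]
        simp [map_ofNat (realizeAt i) 2]
      · intro j _ hj
        rw [Derivation.leibniz_pow, MvPolynomial.pderiv_X_of_ne hj]
        simp
      · simp
    simp only [Derivation.leibniz, map_add, map_mul, smul_eq_mul, Algebra.smul_def,
      Polynomial.algebraMap_eq, hX, hf, realizeAt_C]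

theorem sum_sum_divDiff_X_pow (i : ι) (l : ℕ) :
    ∑ j ∈ Finset.univ.erase i, ∑ η : ℤˣ,
        divDiff (root i j η) (reflection i j η) (MvPolynomial.X i ^ l) =
      2 * realizeAt i (DvalsB l) := by
  rw [Finset.sum_congr rfl fun j hj =>
    sum_divDiff_X_pow (Finset.ne_of_mem_erase hj).symm l, ← Finset.mul_sum]
  congr 1
  rcases Nat.eq_zero_or_pos l with rfl | hl
  · simp [DvalsB]
  rw [Finset.sum_erase_eq_sub (Finset.mem_univ i), Finset.sum_comm, DvalsB, if_neg hl.ne']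
  simp only [map_sub, map_sum, map_mul, map_pow, map_natCast, realizeAt_X, realizeAt_C,
    realize_X, Finset.mul_sum]
  congr 1
  have hc : ∀ m ∈ Finset.range ((l + 1) / 2),
      (MvPolynomial.X i : MvPolynomial ι ℂ) ^ (l - 1 - 2 * m) * MvPolynomial.X i ^ (2 * m) =
        MvPolynomial.X i ^ (l - 1) := by
    intro m hm
    have := Finset.mem_range.1 hm
    rw [← pow_add, show l - 1 - 2 * m + 2 * m = l - 1 by omega]
  rw [Finset.sum_congr rfl hc, Finset.sum_const, Finset.card_range, nsmul_eq_mul]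

variable (k q : ℂ)

theorem DopB_add (F G : LamX) : DopB k q (F + G) = DopB k q F + DopB k q G := by
  have hp : pdB (F + G) = pdB F + pdB G := by
    rw [pdB, Polynomial.sum_add_index _ _ _ (by simp) (by intros; rw [map_add, add_mul]),
      map_add, pdB, pdB]
    ring
  have hd : DelB (F + G) = DelB F + DelB G :=
    Polynomial.sum_add_index _ _ _ (by simp) (by intros; rw [map_add, add_mul])
  have hq : qopB q (F + G) = qopB q F + qopB q G :=
    Polynomial.sum_add_index _ _ _ (by simp) (by intros; rw [map_add, add_mul])
  rw [DopB, hp, hd, hq, DopB, DopB, smul_add]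
  ring

theorem dunkl_realize_mul (i : ι) (c : Lam) (f : MvPolynomial ι ℂ) :
    dunkl k q i (realize ι c * f) =
      realize ι c * dunkl k q i f + MvPolynomial.pderiv i (realize ι c) * f := by
  have hA : ∀ j ∈ Finset.univ.erase i,
      ∑ η : ℤˣ, divDiff (root i j η) (reflection i j η) (realize ι c * f) =
        realize ι c * ∑ η : ℤˣ, divDiff (root i j η) (reflection i j η) f := by
    intro j hj
    rw [Finset.mul_sum]
    exact Finset.sum_congr rfl fun η _ =>
      (isDivisor_root (Finset.ne_of_mem_erase hj).symm η).divDiff_mul_of_fixed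
        (signedPerm_realize _ _ c) f
  have hT : divDiff (MvPolynomial.X i) (signFlip i) (realize ι c * f) =
      realize ι c * divDiff (MvPolynomial.X i) (signFlip i) f :=
    (isDivisor_X i).divDiff_mul_of_fixed (signedPerm_realize _ _ c) f
  rw [dunkl_apply, dunkl_apply, Finset.sum_congr rfl hA, hT, ← Finset.mul_sum,
    Derivation.leibniz]
  simp only [smul_eq_mul, MvPolynomial.smul_eq_C_mul]
  ring

theorem realizeAt_DopB (i : ι) (F : LamX) :
    realizeAt i (DopB k q F) = dunkl k q i (realizeAt i F) := by
  induction F using Polynomial.induction_on' with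
  | add F G hF hG => rw [DopB_add, map_add, hF, hG, map_add, map_add]
  | monomial l c =>
    have hp : realizeAt i (pdB (Polynomial.monomial l c)) =
        MvPolynomial.pderiv i (realize ι c) * MvPolynomial.X i ^ l +
          realize ι c * MvPolynomial.pderiv i (MvPolynomial.X i ^ l) := by
      rw [pdB, Polynomial.sum_monomial_index _ _ (by simp), map_add, map_mul, map_pow,
        realizeAt_X, realizeAt_coeffDerB, Polynomial.derivative_monomial, realizeAt_monomial,
        Derivation.leibniz_pow, MvPolynomial.pderiv_X_self]
      simp
      ring
    have hd : realizeAt i (DelB (Polynomial.monomial l c)) =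
        realize ι c * realizeAt i (DvalsB l) := by
      rw [DelB, Polynomial.sum_monomial_index _ _ (by simp), map_mul, realizeAt_C]
    have hq : realizeAt i (qopB q (Polynomial.monomial l c)) =
        q • (realize ι c * divDiff (MvPolynomial.X i) (signFlip i) (MvPolynomial.X i ^ l)) := by
      rw [qopB, Polynomial.sum_monomial_index _ _ (by simp), map_mul, realizeAt_C,
        realizeAt_smul, map_sub, realizeAt_smul, map_pow, realizeAt_X, divDiff_signFlip_X_pow,
        mul_smul_comm, MvPolynomial.smul_eq_C_mul _ ((-1 : ℂ) ^ l)]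
      simp
    rw [DopB, map_sub, map_sub, realizeAt_smul, hp, hd, hq, realizeAt_monomial,
      dunkl_realize_mul, dunkl_apply, sum_sum_divDiff_X_pow]
    simp only [MvPolynomial.smul_eq_C_mul, map_mul, map_ofNat]
    ring

theorem realizeAt_DopB_iterate (i : ι) (r : ℕ) (F : LamX) :
    realizeAt i ((DopB k q)^[r] F) = (dunkl k q i ^ r) (realizeAt i F) := by
  induction r with
  | zero => rfl
  | succ r ih =>
    rw [Function.iterate_succ_apply', realizeAt_DopB, ih, pow_succ', Module.End.mul_apply]

theorem two_mul_realize_EB (F : LamX) :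
    2 * realize ι (EB F) = ∑ i, (realizeAt i F + signFlip i (realizeAt i F)) := by
  induction F using Polynomial.induction_on' with
  | add F G hF hG =>
    have h : EB (F + G) = EB F + EB G :=
      Polynomial.sum_add_index _ _ _ (by simp) (by intros; split_ifs <;> simp [add_mul])
    rw [h, map_add, mul_add, hF, hG, ← Finset.sum_add_distrib]
    refine Finset.sum_congr rfl fun i _ => ?_
    rw [map_add, map_add]
    ring
  | monomial l c =>
    have hs : ∀ i : ι, signFlip i (realize ι c) = realize ι c :=
      fun i => signedPerm_realize _ _ c
    rw [EB, Polynomial.sum_monomial_index _ _ (by simp)]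
    simp only [realizeAt_monomial, map_mul, map_pow, signFlip_X_self, hs]
    split_ifs with h
    · rw [map_mul, realize_X, Nat.two_mul_div_two_of_even h, Finset.mul_sum, Finset.mul_sum]
      refine Finset.sum_congr rfl fun i _ => ?_
      rw [h.neg_pow]
      ring
    · rw [map_zero, mul_zero, Finset.sum_eq_zero]
      intro i _
      rw [(Nat.not_even_iff_odd.1 h).neg_pow]
      ring

theorem signFlip_dunkl_pow (i : ι) (r : ℕ) (f : MvPolynomial ι ℂ) :
    signFlip i ((dunkl k q i ^ (2 * r)) f) = (dunkl k q i ^ (2 * r)) (signFlip i f) := by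
  induction r generalizing f with
  | zero => rfl
  | succ r ih =>
    rw [Nat.mul_succ, pow_add, Module.End.mul_apply, ih, pow_two, Module.End.mul_apply,
      signFlip_dunkl_self, signFlip_dunkl_self, map_neg (dunkl k q i), neg_neg,
      Module.End.mul_apply, Module.End.mul_apply]

theorem realize_LrB (r : ℕ) (f : Lam) :
    realize ι (LrB k q r f) = (∑ i, dunkl k q i ^ (2 * r)) (realize ι f) := by
  have hs : ∀ i : ι, signFlip i (realize ι f) = realize ι f :=
    fun i => signedPerm_realize _ _ f
  apply mul_left_cancel₀ (two_ne_zero (α := MvPolynomial ι ℂ))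
  rw [LrB, two_mul_realize_EB, LinearMap.sum_apply, Finset.mul_sum]
  refine Finset.sum_congr rfl fun i _ => ?_
  rw [realizeAt_DopB_iterate, realizeAt_C, signFlip_dunkl_pow, hs,
    two_mul ((dunkl k q i ^ (2 * r)) _)]

theorem realize_LrB_LrB_comm (r s : ℕ) (f : Lam) :
    realize ι (LrB k q r (LrB k q s f)) = realize ι (LrB k q s (LrB k q r f)) := by
  have h : Commute (∑ i : ι, dunkl k q i ^ (2 * r)) (∑ i : ι, dunkl k q i ^ (2 * s)) :=
    Commute.sum_left _ _ _ fun i _ => Commute.sum_right _ _ _ fun j _ =>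
      (commute_dunkl k q i j).pow_pow _ _
  simp only [realize_LrB, ← Module.End.mul_apply, h.eq]

end Realization

section Density

theorem eval_aeval {σ : Type} (c : σ → ℂ) (G : ℕ → MvPolynomial σ ℂ) (f : Lam) :
    MvPolynomial.eval c (MvPolynomial.aeval G f) =
      MvPolynomial.eval (fun l => MvPolynomial.eval c (G l)) f := by
  induction f using MvPolynomial.induction_on with
  | C a => simp
  | add f g hf hg => simp only [map_add, hf, hg]
  | mul_X f n hf => simp only [map_mul, hf, MvPolynomial.aeval_X, MvPolynomial.eval_X]

theorem eval_eq_zero_of_realize {f : Lam}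
    (hf : ∀ (ι : Type) [Fintype ι], realize ι f = 0) {M : ℕ} (c : Fin M → ℂ) :
    MvPolynomial.eval (fun l => ∑ i, c i * ((i : ℕ) ^ 2 : ℂ) ^ l) f = 0 := by
  let g : MvPolynomial (Fin M) ℂ := MvPolynomial.aeval
    (fun l => ∑ i : Fin M, MvPolynomial.X i * MvPolynomial.C (((i : ℕ) ^ 2 : ℂ) ^ l)) f
  have hg (c : Fin M → ℂ) : MvPolynomial.eval c g =
      MvPolynomial.eval (fun l => ∑ i, c i * ((i : ℕ) ^ 2 : ℂ) ^ l) f := by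
    simp only [g, eval_aeval, map_sum, map_mul, MvPolynomial.eval_X, MvPolynomial.eval_C]
  have h0 : g = 0 := by
    refine MvPolynomial.funext_set (fun _ => Set.range ((↑) : ℕ → ℂ))
      (fun _ => Set.infinite_range_of_injective Nat.cast_injective) fun x hx => ?_
    choose n hn using fun i => hx i (Set.mem_univ i)
    rw [hg, map_zero]
    have h := congrArg (MvPolynomial.eval fun a : (Σ i : Fin M, Fin (n i)) => ((a.1 : ℕ) : ℂ))
      (hf (Σ i : Fin M, Fin (n i)))
    simp only [realize, eval_aeval, map_sum, map_pow, MvPolynomial.eval_X, map_zero,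
      Fintype.sum_sigma, Finset.sum_const, Finset.card_univ, Fintype.card_fin, nsmul_eq_mul,
      pow_mul, hn] at h
    exact h
  rw [← hg, h0, map_zero]

theorem eq_zero_of_realize {f : Lam} (hf : ∀ (ι : Type) [Fintype ι], realize ι f = 0) :
    f = 0 := by
  refine MvPolynomial.funext fun a => ?_
  obtain ⟨M, hM⟩ : ∃ M : ℕ, ∀ l ∈ f.vars, l < M :=
    ⟨f.vars.sup id + 1, fun l hl => Nat.lt_succ_of_le (Finset.le_sup (f := id) hl)⟩
  let V := Matrix.vandermonde fun i : Fin M => ((i : ℕ) ^ 2 : ℂ)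
  have hV : IsUnit V.det := by
    refine (Matrix.det_vandermonde_ne_zero_iff.2 fun i j hij => ?_).isUnit
    have h : (i : ℕ) ^ 2 = (j : ℕ) ^ 2 := by exact_mod_cast hij
    exact Fin.ext (Nat.pow_left_injective two_ne_zero h)
  let c : Fin M → ℂ := Matrix.vecMul (fun l : Fin M => a l) V⁻¹
  have hc : Matrix.vecMul c V = fun l : Fin M => a l := by
    rw [Matrix.vecMul_vecMul, Matrix.nonsing_inv_mul _ hV, Matrix.vecMul_one]
  rw [map_zero, ← eval_eq_zero_of_realize hf c]
  refine MvPolynomial.eval₂Hom_congr' rfl (fun l hl _ => ?_) rfl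
  exact (congrFun hc ⟨l, hM l hl⟩).symm

end Density

end BDunkl

end

/-- the B-type rational CMS integrals at infinity commute. -/
theorem Btype_CMS_integrals_at_infinity_commute (k q : ℂ) (r s : ℕ)
    (hr : 1 ≤ r) (hs : 1 ≤ s) (f : Lam) :
    LrB k q r (LrB k q s f) = LrB k q s (LrB k q r f) := by
  classical
  refine sub_eq_zero.1 (BDunkl.eq_zero_of_realize fun ι _ => ?_)
  rw [map_sub, BDunkl.realize_LrB_LrB_comm, sub_self]
end
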